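/- Quadratic Morawetz estimate for defocusing NLS (Proposition 2.1(2), kernel form): let n ≥ 2, let g(ρ) = λ₁ρ^{(p₁-1)/2} + λ₂ρ^{(p₂-1)/2} with λ₁, λ₂ ≥ 0 and 1 ≤ p₁ < p₂, so that ρg(ρ) - G(ρ) = λ₁((p₁-1)/(p₁+1))ρ^{(p₁+1)/2} + λ₂((p₂-1)/(p₂+1))ρ^{(p₂+1)/2} ≥ 0. Let u be a smooth decaying solution of the corresponding NLS equation on all of ℝ with sup_t ‖u(t)‖_{L²} < ∞ and sup_t ‖∇u(t)‖_{L²} < ∞. Then ∫_ℝ [ ((n-1)/2) ∫∫ ∇ρ(t,x)·∇ρ(t,y)|x-y|^{-1} dx dy + (n-1) ∫∫ ρ(t,x)|x-y|^{-1}(ρg(ρ)-G(ρ))(t,y) dx dy ] dt ≤ 2 (sup_t ‖u(t)‖_{L²})³ (sup_t ‖∇u(t)‖_{L²}). -/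

import Mathlib

open MeasureTheory Filter Complex

noncomputable section

/-- `ℝⁿ` as a Euclidean space. -/
abbrev Ed (n : ℕ) := EuclideanSpace ℝ (Fin n)

/-- Spatial partial derivative `∂_k` of a complex-valued function. -/
def pd {n : ℕ} (k : Fin n) (f : Ed n → ℂ) (x : Ed n) : ℂ :=
  fderiv ℝ f x (EuclideanSpace.single k 1)

/-- Spatial partial derivative `∂_k` of a real-valued function. -/
def pdR {n : ℕ} (k : Fin n) (f : Ed n → ℝ) (x : Ed n) : ℝ :=
  fderiv ℝ f x (EuclideanSpace.single k 1)

/-- Spatial Laplacian of a complex-valued function. -/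
def lapC {n : ℕ} (f : Ed n → ℂ) (x : Ed n) : ℂ := ∑ k, pd k (fun y => pd k f y) x

/-- Spatial Laplacian of a real-valued function. -/
def lapR {n : ℕ} (f : Ed n → ℝ) (x : Ed n) : ℝ := ∑ k, pdR k (fun y => pdR k f y) x

/-- Second partial derivative `∂_k ∂_l h`. -/
def hess {n : ℕ} (h : Ed n → ℝ) (k l : Fin n) (x : Ed n) : ℝ :=
  pdR k (fun y => pdR l h y) x

/-- `u(t,·)` and all its space-time derivatives are Schwartz in `x`,
uniformly for `t` in compact intervals. -/
def SchwartzDecay {n : ℕ} (u : ℝ → Ed n → ℂ) : Prop :=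
  ∀ (N m : ℕ) (a b : ℝ), ∃ C : ℝ, ∀ t ∈ Set.Icc a b, ∀ x : Ed n,
    (1 + ‖x‖) ^ m * ‖iteratedFDeriv ℝ N (fun p : ℝ × Ed n => u p.1 p.2) (t, x)‖ ≤ C

/-- A smooth decaying solution of the NLS equation `i ∂_t u = -(1/2) Δu + g(|u|²) u`. -/
def IsNLSSolution {n : ℕ} (g : ℝ → ℝ) (u : ℝ → Ed n → ℂ) : Prop :=
  ContDiff ℝ (⊤ : ℕ∞) (fun p : ℝ × Ed n => u p.1 p.2) ∧ SchwartzDecay u ∧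
    ∀ t x, Complex.I * deriv (fun s => u s x) t =
      -(1/2) * lapC (u t) x + ((g (‖u t x‖ ^ 2) : ℝ) : ℂ) * u t x

/-- Mass density `ρ = |u|²`. -/
def dens {n : ℕ} (u : ℝ → Ed n → ℂ) (t : ℝ) (x : Ed n) : ℝ := ‖u t x‖ ^ 2

/-- Mass current `j = Im (ū ∇u)`, `k`-th component. -/
def curr {n : ℕ} (u : ℝ → Ed n → ℂ) (k : Fin n) (t : ℝ) (x : Ed n) : ℝ :=
  ((starRingEnd ℂ) (u t x) * pd k (u t) x).im

/-! ### Decay classes -/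

/-- The integrable weight `(1 + |x|)^{-(n+1)}`. -/
def decayWeight {n : ℕ} (x : Ed n) : ℝ := (1 + ‖x‖) ^ (-((n : ℝ) + 1))

lemma decayWeight_pos {n : ℕ} (x : Ed n) : 0 < decayWeight x :=
  Real.rpow_pos_of_pos (by positivity) _

lemma decayWeight_le_one {n : ℕ} (x : Ed n) : decayWeight x ≤ 1 :=
  Real.rpow_le_one_of_one_le_of_nonpos (by linarith [norm_nonneg x])
    (by linarith [(Nat.cast_nonneg n : (0 : ℝ) ≤ n)])

lemma integrable_decayWeight {n : ℕ} : Integrable (decayWeight (n := n)) :=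
  integrable_one_add_norm (by simp)

lemma decayWeight_eq {n : ℕ} (x : Ed n) : decayWeight x = ((1 + ‖x‖) ^ (n + 1))⁻¹ := by
  rw [decayWeight, Real.rpow_neg (by positivity)]
  norm_cast

/-- Continuous space-time functions that are `O((1 + |x|)^{-(n+1)})`, uniformly for `t` in compact
intervals. -/
def UniformDecay {n : ℕ} (f : ℝ × Ed n → ℝ) : Prop :=
  Continuous f ∧ ∀ a b : ℝ, ∃ C : ℝ, ∀ t ∈ Set.Icc a b, ∀ x, |f (t, x)| ≤ C * decayWeight x

/-- Smooth space-time functions all of whose derivatives are rapidly decreasing in space, uniformly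
for `t` in compact intervals. -/
def UniformSchwartz {n : ℕ} {F : Type*} [NormedAddCommGroup F] [NormedSpace ℝ F]
    (f : ℝ × Ed n → F) : Prop :=
  ContDiff ℝ (⊤ : ℕ∞) f ∧ ∀ (N m : ℕ) (a b : ℝ), ∃ C : ℝ, ∀ t ∈ Set.Icc a b, ∀ x,
    (1 + ‖x‖) ^ m * ‖iteratedFDeriv ℝ N f (t, x)‖ ≤ C

/-- The directional derivative of a space-time function. -/
def dirDeriv {n : ℕ} {F : Type*} [NormedAddCommGroup F] [NormedSpace ℝ F]
    (v : ℝ × Ed n) (f : ℝ × Ed n → F) (p : ℝ × Ed n) : F :=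
  fderiv ℝ f p v

/-- The unit time direction in space-time. -/
def timeDir {n : ℕ} : ℝ × Ed n := (1, 0)

/-- The `k`-th unit space direction in space-time. -/
def spaceDir {n : ℕ} (k : Fin n) : ℝ × Ed n := (0, EuclideanSpace.single k 1)

namespace UniformDecay

variable {n : ℕ} {f g : ℝ × Ed n → ℝ}

lemma exists_nonneg_bound (hf : UniformDecay f) (a b : ℝ) :
    ∃ C : ℝ, 0 ≤ C ∧ ∀ t ∈ Set.Icc a b, ∀ x, |f (t, x)| ≤ C * decayWeight x := by
  obtain ⟨C, hC⟩ := hf.2 a b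
  refine ⟨|C|, abs_nonneg C, fun t ht x => (hC t ht x).trans ?_⟩
  exact mul_le_mul_of_nonneg_right (le_abs_self C) (decayWeight_pos x).le

lemma continuous_slice (hf : UniformDecay f) (t : ℝ) : Continuous fun x => f (t, x) :=
  hf.1.comp (by fun_prop)

lemma integrable_slice (hf : UniformDecay f) (t : ℝ) : Integrable fun x => f (t, x) := by
  obtain ⟨C, hC⟩ := hf.2 t t
  exact (integrable_decayWeight.const_mul C).mono' (hf.continuous_slice t).aestronglyMeasurable
    (Eventually.of_forall fun x => by simpa using hC t (by simp) x)

lemma add (hf : UniformDecay f) (hg : UniformDecay g) : UniformDecay fun p => f p + g p := by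
  refine ⟨hf.1.add hg.1, fun a b => ?_⟩
  obtain ⟨C, hC⟩ := hf.2 a b
  obtain ⟨D, hD⟩ := hg.2 a b
  refine ⟨C + D, fun t ht x => (abs_add_le _ _).trans ?_⟩
  linarith [hC t ht x, hD t ht x]

lemma const_mul (hf : UniformDecay f) (c : ℝ) : UniformDecay fun p => c * f p := by
  refine ⟨hf.1.const_mul c, fun a b => ?_⟩
  obtain ⟨C, hC⟩ := hf.2 a b
  refine ⟨|c| * C, fun t ht x => ?_⟩
  rw [abs_mul, mul_assoc]
  exact mul_le_mul_of_nonneg_left (hC t ht x) (abs_nonneg c)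

lemma sum {ι : Type*} (s : Finset ι) {F : ι → ℝ × Ed n → ℝ} (hF : ∀ i ∈ s, UniformDecay (F i)) :
    UniformDecay fun p => ∑ i ∈ s, F i p := by
  classical
  induction s using Finset.induction_on with
  | empty => exact ⟨by simpa using continuous_const, fun a b => ⟨0, by simp⟩⟩
  | insert i s hi ih =>
    simp only [Finset.sum_insert hi]
    exact (hF i (by simp)).add (ih fun j hj => hF j (by simp [hj]))

/-- A uniformly decaying function stays so after multiplication by a nonnegative power of
another one. -/
lemma rpow_mul (hf : UniformDecay f) (hg : UniformDecay g) {q : ℝ} (hq : 0 ≤ q)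
    (hf0 : ∀ p, 0 ≤ f p) : UniformDecay fun p => f p ^ q * g p := by
  refine ⟨(hf.1.rpow_const fun _ => Or.inr hq).mul hg.1, fun a b => ?_⟩
  obtain ⟨C, hC0, hC⟩ := hf.exists_nonneg_bound a b
  obtain ⟨D, hD⟩ := hg.2 a b
  refine ⟨C ^ q * D, fun t ht x => ?_⟩
  rw [abs_mul, mul_assoc, abs_of_nonneg (Real.rpow_nonneg (hf0 _) q)]
  have h1 : f (t, x) ≤ C :=
    (le_abs_self _).trans ((hC t ht x).trans (mul_le_of_le_one_right hC0 (decayWeight_le_one x)))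
  exact mul_le_mul (Real.rpow_le_rpow (hf0 _) h1 hq) (hD t ht x) (abs_nonneg _)
    (Real.rpow_nonneg hC0 q)

end UniformDecay

namespace UniformSchwartz

variable {n : ℕ} {F G H : Type*} [NormedAddCommGroup F] [NormedSpace ℝ F]
  [NormedAddCommGroup G] [NormedSpace ℝ G] [NormedAddCommGroup H] [NormedSpace ℝ H]

lemma differentiable {f : ℝ × Ed n → F} (hf : UniformSchwartz f) : Differentiable ℝ f :=
  hf.1.differentiable (by simp)

lemma uniformDecay {f : ℝ × Ed n → ℝ} (hf : UniformSchwartz f) : UniformDecay f := by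
  refine ⟨hf.1.continuous, fun a b => ?_⟩
  obtain ⟨C, hC⟩ := hf.2 0 (n + 1) a b
  refine ⟨C, fun t ht x => ?_⟩
  have h := hC t ht x
  rw [norm_iteratedFDeriv_zero, Real.norm_eq_abs] at h
  rw [decayWeight_eq, ← div_eq_mul_inv, le_div_iff₀ (by positivity), mul_comm]
  exact h

lemma dirDeriv {f : ℝ × Ed n → F} (hf : UniformSchwartz f) (v : ℝ × Ed n) :
    UniformSchwartz (dirDeriv v f) := by
  have hd : ContDiff ℝ (⊤ : ℕ∞) (fderiv ℝ f) := hf.1.fderiv_right (by simp)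
  refine ⟨hd.clm_apply contDiff_const, fun N m a b => ?_⟩
  obtain ⟨C, hC⟩ := hf.2 (N + 1) m a b
  let L := ContinuousLinearMap.apply ℝ F v
  refine ⟨‖L‖ * C, fun t ht x => ?_⟩
  have h := L.norm_iteratedFDeriv_comp_left (f := fderiv ℝ f) (x := (t, x)) (n := N)
    hd.contDiffAt (by exact_mod_cast le_top)
  rw [norm_iteratedFDeriv_fderiv] at h
  calc (1 + ‖x‖) ^ m * ‖iteratedFDeriv ℝ N (L ∘ fderiv ℝ f) (t, x)‖
      ≤ (1 + ‖x‖) ^ m * (‖L‖ * ‖iteratedFDeriv ℝ (N + 1) f (t, x)‖) := by gcongr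
    _ = ‖L‖ * ((1 + ‖x‖) ^ m * ‖iteratedFDeriv ℝ (N + 1) f (t, x)‖) := by ring
    _ ≤ ‖L‖ * C := by gcongr; exact hC t ht x

lemma clm_comp {f : ℝ × Ed n → F} (hf : UniformSchwartz f) (L : F →L[ℝ] G) :
    UniformSchwartz fun p => L (f p) := by
  refine ⟨L.contDiff.comp hf.1, fun N m a b => ?_⟩
  obtain ⟨C, hC⟩ := hf.2 N m a b
  refine ⟨‖L‖ * C, fun t ht x => ?_⟩
  have h := L.norm_iteratedFDeriv_comp_left (f := f) (x := (t, x)) (n := N)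
    hf.1.contDiffAt (by exact_mod_cast le_top)
  calc (1 + ‖x‖) ^ m * ‖iteratedFDeriv ℝ N (L ∘ f) (t, x)‖
      ≤ (1 + ‖x‖) ^ m * (‖L‖ * ‖iteratedFDeriv ℝ N f (t, x)‖) := by gcongr
    _ = ‖L‖ * ((1 + ‖x‖) ^ m * ‖iteratedFDeriv ℝ N f (t, x)‖) := by ring
    _ ≤ ‖L‖ * C := by gcongr; exact hC t ht x

lemma bilinear (B : F →L[ℝ] G →L[ℝ] H) {f : ℝ × Ed n → F} {g : ℝ × Ed n → G}
    (hf : UniformSchwartz f) (hg : UniformSchwartz g) :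
    UniformSchwartz fun p => B (f p) (g p) := by
  refine ⟨B.isBoundedBilinearMap.contDiff.comp (hf.1.prodMk hg.1), fun N m a b => ?_⟩
  choose C hC using fun i => hf.2 i m a b
  choose D hD using fun i => hg.2 i 0 a b
  refine ⟨‖B‖ * ∑ i ∈ Finset.range (N + 1), (N.choose i : ℝ) * (C i * D (N - i)),
    fun t ht x => ?_⟩
  have h := B.norm_iteratedFDeriv_le_of_bilinear hf.1 hg.1 (t, x) (n := N)
    (by exact_mod_cast le_top)
  refine (mul_le_mul_of_nonneg_left h (by positivity)).trans ?_
  rw [mul_left_comm, Finset.mul_sum]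
  refine mul_le_mul_of_nonneg_left (Finset.sum_le_sum fun i _ => ?_) (norm_nonneg B)
  have h1 := hC i t ht x
  have h2 := hD (N - i) t ht x
  rw [pow_zero, one_mul] at h2
  calc (1 + ‖x‖) ^ m * (N.choose i * ‖iteratedFDeriv ℝ i f (t, x)‖ *
        ‖iteratedFDeriv ℝ (N - i) g (t, x)‖)
      = N.choose i * (((1 + ‖x‖) ^ m * ‖iteratedFDeriv ℝ i f (t, x)‖) *
        ‖iteratedFDeriv ℝ (N - i) g (t, x)‖) := by ring
    _ ≤ N.choose i * (C i * D (N - i)) := by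
        have : 0 ≤ C i := le_trans (by positivity) h1
        gcongr

lemma const_mul {f : ℝ × Ed n → ℂ} (hf : UniformSchwartz f) (c : ℂ) :
    UniformSchwartz fun p => c * f p :=
  hf.clm_comp (ContinuousLinearMap.mul ℝ ℂ c)

lemma inner {f g : ℝ × Ed n → ℂ} (hf : UniformSchwartz f) (hg : UniformSchwartz g) :
    UniformSchwartz fun p => inner ℝ (f p) (g p) := by
  have h := ((bilinear (ContinuousLinearMap.mul ℝ ℂ) hg
    (hf.clm_comp (conjCLE : ℂ →L[ℝ] ℂ))).clm_comp reCLM)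
  simpa [Complex.inner] using h

end UniformSchwartz

/-! ### Quadratic functionals with a difference kernel -/

/-- Continuous bounded kernels. -/
def BoundedKernel {n : ℕ} (K : Ed n → ℝ) : Prop :=
  Continuous K ∧ ∃ C : ℝ, ∀ z, |K z| ≤ C

/-- The functional `∫∫ K(y - x) f(t,x) g(t,y) dx dy`. -/
def pairing {n : ℕ} (K : Ed n → ℝ) (f g : ℝ × Ed n → ℝ) (t : ℝ) : ℝ :=
  ∫ p : Ed n × Ed n, K (p.2 - p.1) * (f (t, p.1) * g (t, p.2))

section Pairing

variable {n : ℕ} {K K' : Ed n → ℝ} {f f' g g' : ℝ × Ed n → ℝ}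

lemma integrable_decayWeight_prod :
    Integrable fun p : Ed n × Ed n => decayWeight p.1 * decayWeight p.2 :=
  integrable_decayWeight.mul_prod integrable_decayWeight

lemma UniformDecay.exists_prod_bound (hf : UniformDecay f) (hg : UniformDecay g) (a b : ℝ) :
    ∃ C : ℝ, 0 ≤ C ∧ ∀ t ∈ Set.Icc a b, ∀ p : Ed n × Ed n,
      |f (t, p.1) * g (t, p.2)| ≤ C * (decayWeight p.1 * decayWeight p.2) := by
  obtain ⟨C, hC0, hC⟩ := hf.exists_nonneg_bound a b
  obtain ⟨D, hD0, hD⟩ := hg.exists_nonneg_bound a b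
  refine ⟨C * D, mul_nonneg hC0 hD0, fun t ht p => ?_⟩
  rw [abs_mul, mul_mul_mul_comm]
  exact mul_le_mul (hC t ht _) (hD t ht _) (abs_nonneg _)
    (mul_nonneg hC0 (decayWeight_pos _).le)

lemma BoundedKernel.continuous_integrand (hK : BoundedKernel K) (hf : UniformDecay f)
    (hg : UniformDecay g) (t : ℝ) :
    Continuous fun p : Ed n × Ed n => K (p.2 - p.1) * (f (t, p.1) * g (t, p.2)) :=
  (hK.1.comp (by fun_prop)).mul
    ((hf.1.comp (by fun_prop)).mul (hg.1.comp (by fun_prop)))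

lemma BoundedKernel.exists_integrand_bound (hK : BoundedKernel K) (hf : UniformDecay f)
    (hg : UniformDecay g) (a b : ℝ) :
    ∃ C : ℝ, ∀ t ∈ Set.Icc a b, ∀ p : Ed n × Ed n,
      |K (p.2 - p.1) * (f (t, p.1) * g (t, p.2))| ≤ C * (decayWeight p.1 * decayWeight p.2) := by
  obtain ⟨C, hC⟩ := hK.2
  obtain ⟨D, hD0, hD⟩ := hf.exists_prod_bound hg a b
  refine ⟨C * D, fun t ht p => ?_⟩
  rw [abs_mul, mul_assoc]
  exact mul_le_mul (hC _) (hD t ht p) (abs_nonneg _) ((abs_nonneg _).trans (hC 0))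

lemma BoundedKernel.integrable_pairing (hK : BoundedKernel K) (hf : UniformDecay f)
    (hg : UniformDecay g) (t : ℝ) :
    Integrable fun p : Ed n × Ed n => K (p.2 - p.1) * (f (t, p.1) * g (t, p.2)) := by
  obtain ⟨C, hC⟩ := hK.exists_integrand_bound hf hg t t
  exact (integrable_decayWeight_prod.const_mul C).mono'
    (hK.continuous_integrand hf hg t).aestronglyMeasurable
    (Eventually.of_forall fun p => by simpa using hC t (by simp) p)

lemma pairing_const_mul_right (c : ℝ) (t : ℝ) :
    pairing K f (fun p => c * g p) t = c * pairing K f g t := by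
  simp only [pairing, ← integral_const_mul]
  congr 1
  ext p
  ring

lemma pairing_const_mul_left (c : ℝ) (t : ℝ) :
    pairing K (fun p => c * f p) g t = c * pairing K f g t := by
  simp only [pairing, ← integral_const_mul]
  congr 1
  ext p
  ring

lemma BoundedKernel.pairing_add_right (hK : BoundedKernel K) (hf : UniformDecay f)
    (hg : UniformDecay g) (hg' : UniformDecay g') (t : ℝ) :
    pairing K f (fun p => g p + g' p) t = pairing K f g t + pairing K f g' t := by
  simp only [pairing, mul_add]
  exact integral_add (hK.integrable_pairing hf hg t) (hK.integrable_pairing hf hg' t)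

lemma BoundedKernel.pairing_sum_right {ι : Type*} (s : Finset ι) {g : ι → ℝ × Ed n → ℝ}
    (hK : BoundedKernel K) (hf : UniformDecay f) (hg : ∀ i ∈ s, UniformDecay (g i)) (t : ℝ) :
    pairing K f (fun p => ∑ i ∈ s, g i p) t = ∑ i ∈ s, pairing K f (g i) t := by
  simp only [pairing, Finset.mul_sum]
  exact integral_finsetSum s fun i hi => hK.integrable_pairing hf (hg i hi) t

lemma BoundedKernel.pairing_sum_left {ι : Type*} (s : Finset ι) {f : ι → ℝ × Ed n → ℝ}
    (hK : BoundedKernel K) (hf : ∀ i ∈ s, UniformDecay (f i)) (hg : UniformDecay g) (t : ℝ) :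
    pairing K (fun p => ∑ i ∈ s, f i p) g t = ∑ i ∈ s, pairing K (f i) g t := by
  simp only [pairing, Finset.mul_sum, Finset.sum_mul]
  exact integral_finsetSum s fun i hi => hK.integrable_pairing (hf i hi) hg t

lemma pairing_sum_kernel {ι : Type*} (s : Finset ι) {K : ι → Ed n → ℝ}
    (hK : ∀ i ∈ s, BoundedKernel (K i)) (hf : UniformDecay f) (hg : UniformDecay g) (t : ℝ) :
    pairing (fun z => ∑ i ∈ s, K i z) f g t = ∑ i ∈ s, pairing (K i) f g t := by
  simp only [pairing, Finset.sum_mul]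
  exact integral_finsetSum s fun i hi => (hK i hi).integrable_pairing hf hg t

lemma pairing_swap (hK : ∀ z, K (-z) = K z) (t : ℝ) : pairing K f g t = pairing K g f t := by
  rw [pairing, Measure.volume_eq_prod, ← integral_prod_swap]
  refine integral_congr_ae (Eventually.of_forall fun p => ?_)
  have h : K (p.1 - p.2) = K (p.2 - p.1) := by rw [← hK, neg_sub]
  simp only [Prod.fst_swap, Prod.snd_swap, h]
  ring

/-- Integration by parts in the second variable. -/
lemma BoundedKernel.pairing_deriv_right (hK : BoundedKernel K) (hK' : BoundedKernel K')
    (hf : UniformDecay f) (hg : UniformDecay g) (hg' : UniformDecay g') {e : Ed n}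
    (hKd : ∀ z, HasLineDerivAt ℝ K (K' z) z e) (t : ℝ)
    (hgd : ∀ x, HasLineDerivAt ℝ (fun y => g (t, y)) (g' (t, x)) x e) :
    pairing K f g' t = -pairing K' f g t := by
  have : (volume : Measure (Ed n × Ed n)).IsAddHaarMeasure :=
    inferInstanceAs ((volume : Measure (Ed n)).prod volume).IsAddHaarMeasure
  have h := integral_bilinear_hasLineDerivAt_right_eq_neg_left_of_integrable
    (μ := (volume : Measure (Ed n × Ed n))) (B := ContinuousLinearMap.mul ℝ ℝ)
    (f := fun p : Ed n × Ed n => K (p.2 - p.1) * f (t, p.1))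
    (f' := fun p => K' (p.2 - p.1) * f (t, p.1)) (g := fun p => g (t, p.2))
    (g' := fun p => g' (t, p.2)) (v := ((0 : Ed n), e))
    (by simpa [mul_assoc] using hK'.integrable_pairing hf hg t)
    (by simpa [mul_assoc] using hK.integrable_pairing hf hg' t)
    (by simpa [mul_assoc] using hK.integrable_pairing hf hg t)
    (fun p _ => by
      have := (hKd (p.2 - p.1)).mul_const (f (t, p.1))
      simpa [HasLineDerivAt, add_sub_right_comm] using this)
    (fun p _ => by simpa [HasLineDerivAt] using hgd p.2)
  simpa [pairing, mul_assoc] using h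

/-- Integration by parts in the first variable. -/
lemma BoundedKernel.pairing_deriv_left (hK : BoundedKernel K) (hK' : BoundedKernel K')
    (hf : UniformDecay f) (hf' : UniformDecay f') (hg : UniformDecay g) {e : Ed n}
    (hKd : ∀ z, HasLineDerivAt ℝ K (K' z) z e) (t : ℝ)
    (hfd : ∀ x, HasLineDerivAt ℝ (fun y => f (t, y)) (f' (t, x)) x e) :
    pairing K' f g t = pairing K f' g t := by
  have hneg : BoundedKernel fun z => K (-z) :=
    ⟨hK.1.comp continuous_neg, hK.2.imp fun C hC z => hC (-z)⟩
  have hneg' : BoundedKernel fun z => -K' (-z) :=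
    ⟨(hK'.1.comp continuous_neg).neg, hK'.2.imp fun C hC z => by simpa using hC (-z)⟩
  have hswap : ∀ (L : Ed n → ℝ) (a b : ℝ × Ed n → ℝ),
      pairing L a b t = pairing (fun z => L (-z)) b a t := by
    intro L a b
    rw [pairing, Measure.volume_eq_prod, ← integral_prod_swap]
    refine integral_congr_ae (Eventually.of_forall fun p => ?_)
    simp only [Prod.fst_swap, Prod.snd_swap, neg_sub]
    ring
  have h := hneg.pairing_deriv_right hneg' hg hf hf' (e := e) (fun z => by
    have := (hKd (-z)).smul (-1 : ℝ)
    simpa [HasLineDerivAt, add_comm] using this) t hfd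
  rw [hswap K' f g, hswap K f' g, h]
  simp [pairing, integral_neg]

lemma BoundedKernel.hasDerivAt_pairing (hK : BoundedKernel K) (hf : UniformDecay f)
    (hf' : UniformDecay f') (hg : UniformDecay g) (hg' : UniformDecay g')
    (hfd : ∀ t x, HasDerivAt (fun s => f (s, x)) (f' (t, x)) t)
    (hgd : ∀ t x, HasDerivAt (fun s => g (s, x)) (g' (t, x)) t) (t : ℝ) :
    HasDerivAt (pairing K f g) (pairing K f' g t + pairing K f g' t) t := by
  obtain ⟨C, hC⟩ := hK.exists_integrand_bound hf' hg (t - 1) (t + 1)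
  obtain ⟨D, hD⟩ := hK.exists_integrand_bound hf hg' (t - 1) (t + 1)
  have hd := hasDerivAt_integral_of_dominated_loc_of_deriv_le
    (μ := (volume : Measure (Ed n × Ed n)))
    (F := fun s p => K (p.2 - p.1) * (f (s, p.1) * g (s, p.2)))
    (F' := fun s p => K (p.2 - p.1) * (f' (s, p.1) * g (s, p.2)) +
      K (p.2 - p.1) * (f (s, p.1) * g' (s, p.2)))
    (bound := fun p => (C + D) * (decayWeight p.1 * decayWeight p.2))
    (Icc_mem_nhds (by linarith : t - 1 < t) (by linarith : t < t + 1))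
    (Eventually.of_forall fun s => (hK.continuous_integrand hf hg s).aestronglyMeasurable)
    (hK.integrable_pairing hf hg t)
    ((hK.continuous_integrand hf' hg t).add
      (hK.continuous_integrand hf hg' t)).aestronglyMeasurable
    (Eventually.of_forall fun p s hs => by
      rw [add_mul]
      exact (norm_add_le _ _).trans (add_le_add (hC s hs p) (hD s hs p)))
    (integrable_decayWeight_prod.const_mul _)
    (Eventually.of_forall fun p s _ => by
      rw [← mul_add]
      exact ((hfd s p.1).mul (hgd s p.2)).const_mul _)
  rw [integral_add (hK.integrable_pairing hf' hg t) (hK.integrable_pairing hf hg' t)] at hd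
  exact hd.2

lemma BoundedKernel.continuous_pairing (hK : BoundedKernel K) (hf : UniformDecay f)
    (hg : UniformDecay g) : Continuous (pairing K f g) := by
  rw [continuous_iff_continuousAt]
  intro t
  obtain ⟨C, hC⟩ := hK.exists_integrand_bound hf hg (t - 1) (t + 1)
  refine continuousAt_of_dominated
    (bound := fun p => C * (decayWeight p.1 * decayWeight p.2))
    (Eventually.of_forall fun s => (hK.continuous_integrand hf hg s).aestronglyMeasurable)
    ?_ (integrable_decayWeight_prod.const_mul _) (Eventually.of_forall fun p => ?_)
  · filter_upwards [Icc_mem_nhds (by linarith : t - 1 < t) (by linarith : t < t + 1)] with s hs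
    exact Eventually.of_forall fun p => hC s hs p
  · have h1 : Continuous fun s : ℝ => f (s, p.1) := hf.1.comp (by fun_prop)
    have h2 : Continuous fun s : ℝ => g (s, p.2) := hg.1.comp (by fun_prop)
    exact (continuous_const.mul (h1.mul h2)).continuousAt

end Pairing

/-! ### The regularized distance kernel -/

/-- The regularization `(ε² + |z|²)^{1/2}` of `|z|`. -/
def regNorm {n : ℕ} (ε : ℝ) (z : Ed n) : ℝ := √(ε ^ 2 + ‖z‖ ^ 2)

/-- The `k`-th partial derivative of `regNorm ε`. -/
def regGrad {n : ℕ} (ε : ℝ) (k : Fin n) (z : Ed n) : ℝ := z k / regNorm ε z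

/-- The second partial derivatives of `regNorm ε`. -/
def regHess {n : ℕ} (ε : ℝ) (k l : Fin n) (z : Ed n) : ℝ :=
  (if k = l then 1 else 0) / regNorm ε z - z k * z l / regNorm ε z ^ 3

/-- The Laplacian of `regNorm ε`. -/
def regLap {n : ℕ} (ε : ℝ) (z : Ed n) : ℝ := ∑ k, regHess ε k k z

section Kernel

variable {n : ℕ} {ε : ℝ}

lemma regNorm_sq (ε : ℝ) (z : Ed n) : regNorm ε z ^ 2 = ε ^ 2 + ‖z‖ ^ 2 :=
  Real.sq_sqrt (by positivity)

lemma regNorm_pos (hε : 0 < ε) (z : Ed n) : 0 < regNorm ε z :=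
  Real.sqrt_pos.2 (by positivity)

lemma le_regNorm (ε : ℝ) (z : Ed n) : ε ≤ regNorm ε z :=
  Real.le_sqrt_of_sq_le (by nlinarith [sq_nonneg ‖z‖])

lemma norm_le_regNorm (ε : ℝ) (z : Ed n) : ‖z‖ ≤ regNorm ε z :=
  Real.le_sqrt_of_sq_le (by nlinarith [sq_nonneg ε])

lemma abs_coord_le_regNorm (ε : ℝ) (z : Ed n) (k : Fin n) : |z k| ≤ regNorm ε z :=
  (PiLp.norm_apply_le z k).trans (norm_le_regNorm ε z)

lemma continuous_regNorm (ε : ℝ) : Continuous (regNorm (n := n) ε) := by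
  unfold regNorm; fun_prop

@[simp] lemma regNorm_neg (ε : ℝ) (z : Ed n) : regNorm ε (-z) = regNorm ε z := by
  simp [regNorm]

lemma regHess_neg (ε : ℝ) (k l : Fin n) (z : Ed n) : regHess ε k l (-z) = regHess ε k l z := by
  simp [regHess]

lemma regHess_comm (ε : ℝ) (k l : Fin n) (z : Ed n) : regHess ε k l z = regHess ε l k z := by
  simp [regHess, eq_comm, mul_comm]

lemma boundedKernel_regGrad (hε : 0 < ε) (k : Fin n) : BoundedKernel (regGrad ε k) := by
  refine ⟨Continuous.div (by fun_prop) (continuous_regNorm ε) fun z => (regNorm_pos hε z).ne',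
    1, fun z => ?_⟩
  rw [regGrad, abs_div, abs_of_pos (regNorm_pos hε z)]
  exact div_le_one_of_le₀ (abs_coord_le_regNorm ε z k) (regNorm_pos hε z).le

lemma abs_regHess_le (hε : 0 < ε) (k l : Fin n) (z : Ed n) :
    |regHess ε k l z| ≤ 2 / regNorm ε z := by
  have hr := regNorm_pos hε z
  have h1 : |(if k = l then (1 : ℝ) else 0) / regNorm ε z| ≤ 1 / regNorm ε z := by
    rw [abs_div, abs_of_pos hr]
    gcongr
    split_ifs <;> simp
  have h2 : |z k * z l / regNorm ε z ^ 3| ≤ 1 / regNorm ε z := by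
    rw [abs_div, abs_mul, abs_of_pos (pow_pos hr 3), div_le_div_iff₀ (pow_pos hr 3) hr]
    have := mul_le_mul (abs_coord_le_regNorm ε z k) (abs_coord_le_regNorm ε z l)
      (abs_nonneg _) hr.le
    nlinarith
  calc |regHess ε k l z| ≤ _ := abs_sub _ _
    _ ≤ 1 / regNorm ε z + 1 / regNorm ε z := add_le_add h1 h2
    _ = 2 / regNorm ε z := by ring

lemma boundedKernel_regHess (hε : 0 < ε) (k l : Fin n) : BoundedKernel (regHess ε k l) := by
  refine ⟨?_, 2 / ε, fun z => (abs_regHess_le hε k l z).trans ?_⟩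
  · exact (continuous_const.div (continuous_regNorm ε) fun z => (regNorm_pos hε z).ne').sub
      (Continuous.div (by fun_prop) ((continuous_regNorm ε).pow 3)
        fun z => (pow_pos (regNorm_pos hε z) 3).ne')
  · have := le_regNorm ε z
    gcongr

lemma boundedKernel_regLap (hε : 0 < ε) : BoundedKernel (regLap (n := n) ε) := by
  refine ⟨continuous_finsetSum _ fun k _ => (boundedKernel_regHess hε k k).1, ?_⟩
  choose C hC using fun k : Fin n => (boundedKernel_regHess hε k k).2
  exact ⟨∑ k, C k, fun z => (Finset.abs_sum_le_sum_abs _ _).trans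
    (Finset.sum_le_sum fun k _ => hC k z)⟩

lemma hasLineDerivAt_regGrad (hε : 0 < ε) (k l : Fin n) (z : Ed n) :
    HasLineDerivAt ℝ (regGrad ε k) (regHess ε k l z) z (EuclideanSpace.single l 1) := by
  have hr := regNorm_pos hε z
  have hline : HasDerivAt (fun s : ℝ => z + s • EuclideanSpace.single l (1 : ℝ))
      (EuclideanSpace.single l (1 : ℝ)) 0 := by
    simpa using ((hasDerivAt_id (0 : ℝ)).smul_const
      (EuclideanSpace.single l (1 : ℝ))).const_add z
  have hsq := hline.norm_sq
  have hnorm : HasDerivAt (fun s : ℝ => regNorm ε (z + s • EuclideanSpace.single l (1 : ℝ)))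
      (z l / regNorm ε z) 0 := by
    have h := (hsq.const_add (ε ^ 2)).sqrt (by simpa using (by positivity : ε ^ 2 + ‖z‖ ^ 2 ≠ 0))
    refine HasDerivAt.congr_deriv h ?_
    rw [mul_div_mul_left _ _ two_ne_zero]
    simp [regNorm, EuclideanSpace.inner_single_right]
  have hcoord : HasDerivAt (fun s : ℝ => (z + s • EuclideanSpace.single l (1 : ℝ)) k)
      (if k = l then 1 else 0) 0 := by
    have h := (EuclideanSpace.proj (𝕜 := ℝ) k).hasFDerivAt.comp_hasDerivAt (0 : ℝ) hline
    simpa [Pi.single_apply, Function.comp_def] using h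
  have h := hcoord.div hnorm (by simpa using hr.ne')
  refine HasDerivAt.congr_deriv h ?_
  simp only [zero_smul, add_zero, regHess]
  field_simp

lemma regLap_eq (ε : ℝ) (z : Ed n) :
    regLap ε z = n / regNorm ε z - ‖z‖ ^ 2 / regNorm ε z ^ 3 := by
  simp only [regLap, regHess, if_true, Finset.sum_sub_distrib, ← Finset.sum_div,
    EuclideanSpace.real_norm_sq_eq, ← pow_two]
  simp

lemma abs_regLap_le (ε : ℝ) {z : Ed n} (hz : z ≠ 0) : |regLap ε z| ≤ (n + 1) * ‖z‖⁻¹ := by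
  have hz' : 0 < ‖z‖ := norm_pos_iff.2 hz
  have hr : 0 < regNorm ε z := hz'.trans_le (norm_le_regNorm ε z)
  have h1 : ‖z‖ ^ 2 / regNorm ε z ^ 3 ≤ 1 / regNorm ε z := by
    rw [div_le_div_iff₀ (pow_pos hr 3) hr, one_mul, pow_succ (regNorm ε z) 2]
    exact mul_le_mul_of_nonneg_right (by rw [regNorm_sq]; nlinarith [sq_nonneg ε]) hr.le
  calc |regLap ε z| ≤ |n / regNorm ε z| + |‖z‖ ^ 2 / regNorm ε z ^ 3| := by
        rw [regLap_eq]; exact abs_sub _ _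
    _ ≤ n / regNorm ε z + 1 / regNorm ε z := by
        rw [abs_of_nonneg (by positivity), abs_of_nonneg (by positivity)]
        gcongr
    _ = (n + 1) * (regNorm ε z)⁻¹ := by ring
    _ ≤ (n + 1) * ‖z‖⁻¹ := by
        gcongr
        exact norm_le_regNorm ε z

/-- Convexity of `regNorm ε`. -/
lemma regHess_nonneg (hε : 0 < ε) (z : Ed n) (a : Fin n → ℝ) :
    0 ≤ ∑ k, ∑ l, regHess ε k l z * (a k * a l) := by
  have hr := regNorm_pos hε z
  have h : ∑ k, ∑ l, regHess ε k l z * (a k * a l) =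
      (∑ k, a k ^ 2) / regNorm ε z - (∑ k, z k * a k) ^ 2 / regNorm ε z ^ 3 := by
    have h1 : ∀ k l, regHess ε k l z * (a k * a l) =
        (if k = l then a k * a l / regNorm ε z else 0) -
          (z k * a k) * (z l * a l) / regNorm ε z ^ 3 := by
      intro k l
      unfold regHess
      split_ifs <;> ring
    simp only [h1, Finset.sum_sub_distrib, ← Finset.sum_div, ← Finset.mul_sum, ← Finset.sum_mul,
      Finset.sum_ite_eq, Finset.mem_univ, if_true, pow_two]
  have hcs := Finset.sum_mul_sq_le_sq_mul_sq Finset.univ (fun k => z k) a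
  rw [← EuclideanSpace.real_norm_sq_eq] at hcs
  rw [h, sub_nonneg, div_le_div_iff₀ (pow_pos hr 3) hr]
  have hz : ‖z‖ ^ 2 ≤ regNorm ε z ^ 2 := by rw [regNorm_sq]; nlinarith [sq_nonneg ε]
  have ha : 0 ≤ ∑ k, a k ^ 2 := Finset.sum_nonneg fun k _ => sq_nonneg _
  have : (∑ k, z k * a k) ^ 2 ≤ regNorm ε z ^ 2 * ∑ k, a k ^ 2 :=
    hcs.trans (mul_le_mul_of_nonneg_right hz ha)
  nlinarith

lemma abs_sum_regGrad_mul_le (hε : 0 < ε) (z : Ed n) (a : Fin n → ℝ) :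
    |∑ k, regGrad ε k z * a k| ≤ √(∑ k, a k ^ 2) := by
  have hr := regNorm_pos hε z
  refine Real.abs_le_sqrt ((Finset.sum_mul_sq_le_sq_mul_sq _ _ _).trans ?_)
  refine mul_le_of_le_one_left (Finset.sum_nonneg fun k _ => sq_nonneg _) ?_
  simp only [regGrad, div_pow, ← Finset.sum_div, ← EuclideanSpace.real_norm_sq_eq]
  rw [div_le_one (by positivity), regNorm_sq]
  nlinarith [sq_nonneg ε]

lemma tendsto_regLap {z : Ed n} (hz : z ≠ 0) :
    Tendsto (fun ε => regLap ε z) (nhdsWithin 0 (Set.Ioi 0)) (nhds ((n - 1) * ‖z‖⁻¹)) := by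
  have hz' : ‖z‖ ≠ 0 := norm_ne_zero_iff.2 hz
  have h0 : regNorm 0 z = ‖z‖ := by simp [regNorm]
  have hc : ContinuousAt (fun ε : ℝ => regNorm ε z) 0 := by
    unfold regNorm; fun_prop
  have h : ContinuousAt (fun ε : ℝ => n / regNorm ε z - ‖z‖ ^ 2 / regNorm ε z ^ 3) 0 :=
    (continuousAt_const.div hc (by rwa [h0])).sub
      (continuousAt_const.div (hc.pow 3) (by rw [h0]; positivity))
  have hlim := h.tendsto.mono_left (nhdsWithin_le_nhds (s := Set.Ioi (0 : ℝ)))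
  have heq : (n : ℝ) / regNorm 0 z - ‖z‖ ^ 2 / regNorm 0 z ^ 3 = (n - 1) * ‖z‖⁻¹ := by
    rw [h0]; field_simp
  rw [heq] at hlim
  exact hlim.congr fun ε => (regLap_eq ε z).symm

end Kernel

/-! ### The kernel `|z|⁻¹` as a limit of regularized Laplacians -/

section SingularKernel

variable {n : ℕ} {f g : ℝ × Ed n → ℝ}

lemma integrable_inv_norm_near_zero (hn : 2 ≤ n) :
    Integrable fun z : Ed n => (Set.Iio (1 : ℝ)).indicator (fun r => r⁻¹) ‖z‖ := by
  have : Nonempty (Fin n) := ⟨⟨0, by omega⟩⟩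
  rw [integrable_fun_norm_addHaar volume (f := (Set.Iio (1 : ℝ)).indicator fun r => r⁻¹)]
  have h1 : IntegrableOn ((Set.Iio (1 : ℝ)).indicator fun _ => (1 : ℝ)) (Set.Ioi 0) := by
    rw [IntegrableOn, integrable_indicator_iff measurableSet_Iio, IntegrableOn,
      Measure.restrict_restrict measurableSet_Iio, Set.Iio_inter_Ioi]
    exact integrableOn_const (by simp)
  refine h1.mono' ?_ ?_
  · exact ((measurable_id.pow_const _).smul
      (measurable_inv.indicator measurableSet_Iio)).aestronglyMeasurable
  · refine (ae_restrict_iff' measurableSet_Ioi).2 (Eventually.of_forall fun r hr => ?_)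
    have hr0 : 0 < r := hr
    by_cases h : r < 1
    · obtain ⟨m, rfl⟩ := Nat.exists_eq_add_of_le' hn
      simp only [finrank_euclideanSpace, Fintype.card_fin, Set.indicator, Set.mem_Iio, h, if_true,
        smul_eq_mul]
      rw [show m + 2 - 1 = m + 1 by omega, pow_succ, mul_assoc, mul_inv_cancel₀ hr0.ne', mul_one,
        Real.norm_of_nonneg (by positivity)]
      exact pow_le_one₀ hr0.le h.le
    · simp [Set.indicator, h]

lemma integrable_inv_norm_mul_decayWeight (hn : 2 ≤ n) :
    Integrable fun p : Ed n × Ed n => ‖p.2 - p.1‖⁻¹ * (decayWeight p.1 * decayWeight p.2) := by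
  have h1 := (integrable_decayWeight (n := n)).convolution_integrand (ContinuousLinearMap.mul ℝ ℝ)
    (integrable_inv_norm_near_zero hn)
  have hc : Continuous (decayWeight (n := n)) := by
    unfold decayWeight
    exact (by fun_prop : Continuous fun x : Ed n => 1 + ‖x‖).rpow_const
      fun x => Or.inl (by positivity)
  refine (h1.add integrable_decayWeight_prod).mono' ?_ (Eventually.of_forall fun p => ?_)
  · exact ((measurable_snd.sub measurable_fst).norm.inv.mul
      (by fun_prop : Continuous fun p : Ed n × Ed n =>
        decayWeight p.1 * decayWeight p.2).measurable).aestronglyMeasurable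
  · have hw1 := decayWeight_pos p.1
    have hw2 := decayWeight_pos p.2
    rw [Real.norm_of_nonneg (by positivity)]
    simp only [Pi.add_apply, ContinuousLinearMap.mul_apply', norm_sub_rev p.1 p.2]
    by_cases h : ‖p.2 - p.1‖ < 1
    · simp only [Set.indicator, Set.mem_Iio, h, if_true]
      have : ‖p.2 - p.1‖⁻¹ * (decayWeight p.1 * decayWeight p.2) ≤
          ‖p.2 - p.1‖⁻¹ * (1 * decayWeight p.2) := by
        gcongr
        exact decayWeight_le_one _
      nlinarith [mul_pos hw1 hw2]
    · simp only [Set.indicator, Set.mem_Iio, h, if_false, mul_zero, zero_add]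
      exact mul_le_of_le_one_left (by positivity) (inv_le_one_of_one_le₀ (not_lt.1 h))

lemma integrable_inv_norm_pairing (hn : 2 ≤ n) (hf : UniformDecay f) (hg : UniformDecay g)
    (c t : ℝ) :
    Integrable fun p : Ed n × Ed n => c * ‖p.2 - p.1‖⁻¹ * (f (t, p.1) * g (t, p.2)) := by
  obtain ⟨C, hC0, hC⟩ := hf.exists_prod_bound hg t t
  refine ((integrable_inv_norm_mul_decayWeight hn).const_mul (|c| * C)).mono' ?_
    (Eventually.of_forall fun p => ?_)
  · have h1 : Continuous fun p : Ed n × Ed n => f (t, p.1) * g (t, p.2) :=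
      (hf.1.comp (by fun_prop)).mul (hg.1.comp (by fun_prop))
    exact ((measurable_const.mul (measurable_snd.sub measurable_fst).norm.inv).mul
      h1.measurable).aestronglyMeasurable
  · rw [norm_mul, norm_mul, norm_inv, norm_norm, Real.norm_eq_abs c]
    have := mul_le_mul_of_nonneg_left (hC t (by simp) p)
      (by positivity : 0 ≤ |c| * ‖p.2 - p.1‖⁻¹)
    rw [Real.norm_eq_abs]
    calc _ ≤ _ := this
      _ = _ := by ring

lemma ae_sub_ne_zero (hn : 2 ≤ n) : ∀ᵐ p : Ed n × Ed n, p.2 - p.1 ≠ 0 := by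
  have : Nonempty (Fin n) := ⟨⟨0, by omega⟩⟩
  have hm : MeasurableSet {p : Ed n × Ed n | p.2 - p.1 ≠ 0} :=
    (measurable_snd.sub measurable_fst) (measurableSet_singleton (0 : Ed n)).compl
  rw [Measure.volume_eq_prod, Measure.ae_prod_iff_ae_ae hm]
  refine Eventually.of_forall fun x => ?_
  have h : ∀ᵐ y : Ed n, y ≠ x := by simp [ae_iff]
  filter_upwards [h] with y hy
  exact sub_ne_zero.2 hy

lemma exists_regLap_integrand_bound (hf : UniformDecay f) (hg : UniformDecay g) (a b : ℝ) :
    ∃ C : ℝ, ∀ ε : ℝ, ∀ t ∈ Set.Icc a b, ∀ p : Ed n × Ed n, p.2 - p.1 ≠ 0 →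
      ‖regLap ε (p.2 - p.1) * (f (t, p.1) * g (t, p.2))‖ ≤
        C * (‖p.2 - p.1‖⁻¹ * (decayWeight p.1 * decayWeight p.2)) := by
  obtain ⟨C, hC0, hC⟩ := hf.exists_prod_bound hg a b
  refine ⟨(n + 1) * C, fun ε t ht p hp => ?_⟩
  rw [norm_mul, Real.norm_eq_abs, Real.norm_eq_abs]
  calc _ ≤ ((n + 1) * ‖p.2 - p.1‖⁻¹) * (C * (decayWeight p.1 * decayWeight p.2)) :=
        mul_le_mul (abs_regLap_le ε hp) (hC t ht p) (abs_nonneg _) (by positivity)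
    _ = _ := by ring

lemma exists_pairing_regLap_bound (hn : 2 ≤ n) (hf : UniformDecay f) (hg : UniformDecay g)
    (a b : ℝ) :
    ∃ C : ℝ, ∀ ε : ℝ, ∀ t ∈ Set.Icc a b, ‖pairing (regLap ε) f g t‖ ≤ C := by
  obtain ⟨C, hC⟩ := exists_regLap_integrand_bound hf hg a b
  refine ⟨_, fun ε t ht => norm_integral_le_of_norm_le
    ((integrable_inv_norm_mul_decayWeight hn).const_mul C) ?_⟩
  filter_upwards [ae_sub_ne_zero hn] with p hp
  exact hC ε t ht p hp

lemma tendsto_pairing_regLap (hn : 2 ≤ n) (hf : UniformDecay f) (hg : UniformDecay g) (t : ℝ) :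
    Tendsto (fun ε => pairing (regLap ε) f g t) (nhdsWithin 0 (Set.Ioi 0))
      (nhds (pairing (fun z => (n - 1) * ‖z‖⁻¹) f g t)) := by
  obtain ⟨C, hC⟩ := exists_regLap_integrand_bound hf hg t t
  refine tendsto_integral_filter_of_dominated_convergence _ ?_ ?_
    ((integrable_inv_norm_mul_decayWeight hn).const_mul C) ?_
  · filter_upwards [self_mem_nhdsWithin] with ε hε
    exact ((boundedKernel_regLap hε).continuous_integrand hf hg t).aestronglyMeasurable
  · refine Eventually.of_forall fun ε => ?_
    filter_upwards [ae_sub_ne_zero hn] with p hp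
    exact hC ε t (by simp) p hp
  · filter_upwards [ae_sub_ne_zero hn] with p hp
    exact (tendsto_regLap hp).mul_const _

end SingularKernel

/-! ### Local conservation laws -/

section DirDeriv

variable {n : ℕ}

lemma dirDeriv_inner {f g : ℝ × Ed n → ℂ} (hf : Differentiable ℝ f) (hg : Differentiable ℝ g)
    (v p : ℝ × Ed n) :
    dirDeriv v (fun q => inner ℝ (f q) (g q)) p =
      inner ℝ (dirDeriv v f p) (g p) + inner ℝ (f p) (dirDeriv v g p) := by
  rw [dirDeriv, fderiv_inner_apply ℝ (hf p) (hg p), add_comm]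
  rfl

lemma dirDeriv_add {F : Type*} [NormedAddCommGroup F] [NormedSpace ℝ F] {f g : ℝ × Ed n → F}
    (hf : Differentiable ℝ f) (hg : Differentiable ℝ g) (v p : ℝ × Ed n) :
    dirDeriv v (fun q => f q + g q) p = dirDeriv v f p + dirDeriv v g p := by
  simp [dirDeriv, fderiv_fun_add (hf p) (hg p)]

lemma dirDeriv_sum {ι : Type*} (s : Finset ι) {f : ι → ℝ × Ed n → ℂ}
    (hf : ∀ i, Differentiable ℝ (f i)) (v p : ℝ × Ed n) :
    dirDeriv v (fun q => ∑ i ∈ s, f i q) p = ∑ i ∈ s, dirDeriv v (f i) p := by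
  simp [dirDeriv, fderiv_fun_sum fun i _ => hf i p]

lemma dirDeriv_const_mul {A : Type*} [NormedRing A] [NormedAlgebra ℝ A] {f : ℝ × Ed n → A}
    (hf : Differentiable ℝ f) (c : A) (v p : ℝ × Ed n) :
    dirDeriv v (fun q => c * f q) p = c * dirDeriv v f p := by
  simp [dirDeriv, fderiv_const_mul (hf p)]

lemma dirDeriv_comm {F : Type*} [NormedAddCommGroup F] [NormedSpace ℝ F] {f : ℝ × Ed n → F}
    (hf : ContDiff ℝ (⊤ : ℕ∞) f) (v w p : ℝ × Ed n) :
    dirDeriv v (dirDeriv w f) p = dirDeriv w (dirDeriv v f) p := by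
  have hd : DifferentiableAt ℝ (fderiv ℝ f) p :=
    (hf.fderiv_right (m := (⊤ : ℕ∞)) (by simp)).differentiable (by simp) p
  have h : ∀ v w : ℝ × Ed n, dirDeriv v (dirDeriv w f) p = fderiv ℝ (fderiv ℝ f) p v w := by
    intro v w
    have := fderiv_clm_apply hd (differentiableAt_const w)
    rw [dirDeriv, show dirDeriv w f = fun q => fderiv ℝ f q w from rfl, this]
    simp
  rw [h, h]
  have h2 : ((2 : ℕ∞) : WithTop ℕ∞) ≤ ((⊤ : ℕ∞) : WithTop ℕ∞) := WithTop.coe_le_coe.2 le_top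
  exact (hf.contDiffAt.isSymmSndFDerivAt (by simpa using h2)) v w

lemma hasDerivAt_time {F : Type*} [NormedAddCommGroup F] [NormedSpace ℝ F] {f : ℝ × Ed n → F}
    (hf : Differentiable ℝ f) (t : ℝ) (x : Ed n) :
    HasDerivAt (fun s => f (s, x)) (dirDeriv timeDir f (t, x)) t :=
  (hf (t, x)).hasFDerivAt.comp_hasDerivAt t ((hasDerivAt_id t).prodMk (hasDerivAt_const t x))

lemma hasFDerivAt_slice {F : Type*} [NormedAddCommGroup F] [NormedSpace ℝ F] {f : ℝ × Ed n → F}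
    (hf : Differentiable ℝ f) (t : ℝ) (x : Ed n) :
    HasFDerivAt (fun y => f (t, y))
      ((fderiv ℝ f (t, x)).comp (ContinuousLinearMap.inr ℝ ℝ (Ed n))) x :=
  (hf (t, x)).hasFDerivAt.comp x (hasFDerivAt_prodMk_right t x)

lemma fderiv_slice {F : Type*} [NormedAddCommGroup F] [NormedSpace ℝ F] {f : ℝ × Ed n → F}
    (hf : Differentiable ℝ f) (k : Fin n) (t : ℝ) (x : Ed n) :
    fderiv ℝ (fun y => f (t, y)) x (EuclideanSpace.single k 1) =
      dirDeriv (spaceDir k) f (t, x) := by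
  simp [(hasFDerivAt_slice hf t x).fderiv, dirDeriv, spaceDir]

lemma hasLineDerivAt_space {f : ℝ × Ed n → ℝ} (hf : Differentiable ℝ f) (k : Fin n) (t : ℝ)
    (x : Ed n) :
    HasLineDerivAt ℝ (fun y => f (t, y)) (dirDeriv (spaceDir k) f (t, x)) x
      (EuclideanSpace.single k 1) := by
  simpa [dirDeriv, spaceDir] using
    (hasFDerivAt_slice hf t x).hasLineDerivAt (EuclideanSpace.single k 1)

end DirDeriv

section ConservationLaws

variable {n : ℕ} {U : ℝ × Ed n → ℂ}

/-- The mass density `|U|²` of a space-time function. -/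
def massDensity (U : ℝ × Ed n → ℂ) (p : ℝ × Ed n) : ℝ := inner ℝ (U p) (U p)

/-- The mass current `Im (Ū ∂_k U)` of a space-time function. -/
def massCurrent (U : ℝ × Ed n → ℂ) (k : Fin n) (p : ℝ × Ed n) : ℝ :=
  inner ℝ (I * U p) (dirDeriv (spaceDir k) U p)

/-- The stress tensor `Re (∂_k Ū ∂_l U)` of a space-time function. -/
def stress (U : ℝ × Ed n → ℂ) (k l : Fin n) (p : ℝ × Ed n) : ℝ :=
  inner ℝ (dirDeriv (spaceDir k) U p) (dirDeriv (spaceDir l) U p)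

/-- The pressure `ρ g(ρ) - G(ρ)` of the sum of two power nonlinearities. -/
def pressure (p₁ p₂ lam₁ lam₂ : ℝ) (U : ℝ × Ed n → ℂ) (p : ℝ × Ed n) : ℝ :=
  lam₁ * ((p₁ - 1) / (p₁ + 1)) * massDensity U p ^ ((p₁ + 1) / 2) +
    lam₂ * ((p₂ - 1) / (p₂ + 1)) * massDensity U p ^ ((p₂ + 1) / 2)

/-- The partial derivatives of the pressure. -/
def pressureGrad (p₁ p₂ lam₁ lam₂ : ℝ) (U : ℝ × Ed n → ℂ) (k : Fin n) (p : ℝ × Ed n) : ℝ :=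
  lam₁ * ((p₁ - 1) / 2) *
      (massDensity U p ^ ((p₁ - 1) / 2) * dirDeriv (spaceDir k) (massDensity U) p) +
    lam₂ * ((p₂ - 1) / 2) *
      (massDensity U p ^ ((p₂ - 1) / 2) * dirDeriv (spaceDir k) (massDensity U) p)

/-- The nonlinear Schrödinger equation with the sum of two power nonlinearities, in space-time
form. -/
def SolvesNLS (p₁ p₂ lam₁ lam₂ : ℝ) (U : ℝ × Ed n → ℂ) : Prop :=
  ∀ p, I * dirDeriv timeDir U p =
    -(1 / 2) * ∑ l, dirDeriv (spaceDir l) (dirDeriv (spaceDir l) U) p +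
      ((lam₁ * massDensity U p ^ ((p₁ - 1) / 2) + lam₂ * massDensity U p ^ ((p₂ - 1) / 2) : ℝ) : ℂ)
        * U p

lemma massDensity_eq (U : ℝ × Ed n → ℂ) (p : ℝ × Ed n) : massDensity U p = ‖U p‖ ^ 2 :=
  real_inner_self_eq_norm_sq _

lemma massDensity_nonneg (U : ℝ × Ed n → ℂ) (p : ℝ × Ed n) : 0 ≤ massDensity U p :=
  real_inner_self_nonneg

namespace UniformSchwartz

lemma massDensity (hU : UniformSchwartz U) : UniformSchwartz (massDensity U) := hU.inner hU

lemma massCurrent (hU : UniformSchwartz U) (k : Fin n) : UniformSchwartz (massCurrent U k) :=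
  (hU.const_mul I).inner (hU.dirDeriv _)

lemma stress (hU : UniformSchwartz U) (k l : Fin n) : UniformSchwartz (stress U k l) :=
  (hU.dirDeriv _).inner (hU.dirDeriv _)

lemma massDensity_rpow (hU : UniformSchwartz U) {q : ℝ} (hq : 1 ≤ q) :
    UniformDecay fun p => _root_.massDensity U p ^ ((q + 1) / 2) := by
  have h := hU.massDensity.uniformDecay.rpow_mul hU.massDensity.uniformDecay
    (by linarith : 0 ≤ (q - 1) / 2) (massDensity_nonneg U)
  convert h using 2 with p
  rw [← Real.rpow_add_one' (massDensity_nonneg U p) (by linarith)]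
  congr 1
  ring

lemma pressure (hU : UniformSchwartz U) {p₁ p₂ : ℝ} (hp₁ : 1 ≤ p₁) (hp₂ : 1 ≤ p₂)
    (lam₁ lam₂ : ℝ) : UniformDecay (pressure p₁ p₂ lam₁ lam₂ U) :=
  ((hU.massDensity_rpow hp₁).const_mul _).add ((hU.massDensity_rpow hp₂).const_mul _)

lemma pressureGrad (hU : UniformSchwartz U) {p₁ p₂ : ℝ} (hp₁ : 1 ≤ p₁) (hp₂ : 1 ≤ p₂)
    (lam₁ lam₂ : ℝ) (k : Fin n) : UniformDecay (pressureGrad p₁ p₂ lam₁ lam₂ U k) := by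
  have h : ∀ {q : ℝ}, 1 ≤ q → UniformDecay fun p => _root_.massDensity U p ^ ((q - 1) / 2) *
      _root_.dirDeriv (spaceDir k) (_root_.massDensity U) p := fun hq =>
    hU.massDensity.uniformDecay.rpow_mul (hU.massDensity.dirDeriv _).uniformDecay
      (by linarith) (massDensity_nonneg U)
  exact ((h hp₁).const_mul _).add ((h hp₂).const_mul _)

end UniformSchwartz

lemma dirDeriv_massDensity (hU : UniformSchwartz U) (v p : ℝ × Ed n) :
    dirDeriv v (massDensity U) p = 2 * inner ℝ (U p) (dirDeriv v U p) := by
  have h := dirDeriv_inner hU.differentiable hU.differentiable v p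
  rw [real_inner_comm] at h
  exact h.trans (two_mul _).symm

lemma hasFDerivAt_massDensity_rpow (hU : UniformSchwartz U) {q : ℝ} (hq : 1 ≤ q)
    (p : ℝ × Ed n) :
    HasFDerivAt (fun p => massDensity U p ^ ((q + 1) / 2))
      (((q + 1) / 2 * massDensity U p ^ ((q - 1) / 2)) • fderiv ℝ (massDensity U) p) p := by
  have h := (hU.massDensity.differentiable p).hasFDerivAt.rpow_const (p := (q + 1) / 2)
    (Or.inr (by linarith))
  rwa [show (q + 1) / 2 - 1 = (q - 1) / 2 by ring] at h

lemma differentiable_pressure (hU : UniformSchwartz U) {p₁ p₂ : ℝ} (hp₁ : 1 ≤ p₁)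
    (hp₂ : 1 ≤ p₂) (lam₁ lam₂ : ℝ) : Differentiable ℝ (pressure p₁ p₂ lam₁ lam₂ U) := fun p =>
  (((hasFDerivAt_massDensity_rpow hU hp₁ p).const_mul _).add
    ((hasFDerivAt_massDensity_rpow hU hp₂ p).const_mul _)).differentiableAt

lemma dirDeriv_pressure (hU : UniformSchwartz U) {p₁ p₂ : ℝ} (hp₁ : 1 ≤ p₁)
    (hp₂ : 1 ≤ p₂) (lam₁ lam₂ : ℝ) (k : Fin n) (p : ℝ × Ed n) :
    dirDeriv (spaceDir k) (pressure p₁ p₂ lam₁ lam₂ U) p =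
      pressureGrad p₁ p₂ lam₁ lam₂ U k p := by
  have h := ((hasFDerivAt_massDensity_rpow hU hp₁ p).const_mul
    (lam₁ * ((p₁ - 1) / (p₁ + 1)))).add ((hasFDerivAt_massDensity_rpow hU hp₂ p).const_mul
    (lam₂ * ((p₂ - 1) / (p₂ + 1))))
  have h' : fderiv ℝ (pressure p₁ p₂ lam₁ lam₂ U) p = _ := h.fderiv
  have h1 : p₁ + 1 ≠ 0 := by linarith
  have h2 : p₂ + 1 ≠ 0 := by linarith
  rw [dirDeriv, h']
  simp only [add_apply, smul_apply, smul_eq_mul,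
    pressureGrad, dirDeriv]
  field_simp

/-- Local conservation of mass. -/
lemma dirDeriv_time_massDensity (hU : UniformSchwartz U) {p₁ p₂ lam₁ lam₂ : ℝ}
    (h : SolvesNLS p₁ p₂ lam₁ lam₂ U) (p : ℝ × Ed n) :
    dirDeriv timeDir (massDensity U) p =
      ∑ l, (-1) * dirDeriv (spaceDir l) (massCurrent U l) p := by
  have hj : ∀ l, dirDeriv (spaceDir l) (massCurrent U l) p =
      inner ℝ (I * U p) (dirDeriv (spaceDir l) (dirDeriv (spaceDir l) U) p) := by
    intro l
    have := dirDeriv_inner (hU.const_mul I).differentiable (hU.dirDeriv (spaceDir l)).differentiable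
      (spaceDir l) p
    refine Eq.trans this ?_
    rw [dirDeriv_const_mul hU.differentiable]
    simp [Complex.inner]
    ring
  have hI : inner ℝ (U p) (dirDeriv timeDir U p) =
      inner ℝ (I * U p) (I * dirDeriv timeDir U p) := by
    simp [Complex.inner]
  rw [dirDeriv_massDensity hU, hI, h p]
  simp only [hj, ← Finset.mul_sum, ← inner_sum]
  simp [Complex.inner]
  ring

lemma dirDeriv_stress_sub (hU : UniformSchwartz U) (k l : Fin n) (p : ℝ × Ed n) :
    (-1) * dirDeriv (spaceDir l) (stress U k l) p + 1 / 4 *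
      dirDeriv (spaceDir l) (dirDeriv (spaceDir k) (dirDeriv (spaceDir l) (massDensity U))) p =
    1 / 2 * inner ℝ (U p)
        (dirDeriv (spaceDir k) (dirDeriv (spaceDir l) (dirDeriv (spaceDir l) U)) p) -
      1 / 2 * inner ℝ (dirDeriv (spaceDir l) (dirDeriv (spaceDir l) U) p)
        (dirDeriv (spaceDir k) U p) := by
  have hd := hU.differentiable
  have hdl := (hU.dirDeriv (spaceDir l)).differentiable
  have hdk := (hU.dirDeriv (spaceDir k)).differentiable
  have hdkl := ((hU.dirDeriv (spaceDir l)).dirDeriv (spaceDir k)).differentiable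
  have h1 : dirDeriv (spaceDir l) (stress U k l) p = _ := dirDeriv_inner hdk hdl (spaceDir l) p
  have h2 : dirDeriv (spaceDir l) (massDensity U) = fun q =>
      2 * inner ℝ (U q) (dirDeriv (spaceDir l) U q) :=
    funext fun q => dirDeriv_massDensity hU _ q
  have h3 : dirDeriv (spaceDir k) (dirDeriv (spaceDir l) (massDensity U)) = fun q =>
      2 * (inner ℝ (dirDeriv (spaceDir k) U q) (dirDeriv (spaceDir l) U q) +
        inner ℝ (U q) (dirDeriv (spaceDir k) (dirDeriv (spaceDir l) U) q)) := by
    funext q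
    rw [h2, dirDeriv_const_mul (hd.inner ℝ hdl), dirDeriv_inner hd hdl]
  have hdiff : Differentiable ℝ fun q =>
      inner ℝ (dirDeriv (spaceDir k) U q) (dirDeriv (spaceDir l) U q) +
        inner ℝ (U q) (dirDeriv (spaceDir k) (dirDeriv (spaceDir l) U) q) :=
    (hdk.inner ℝ hdl).add (hd.inner ℝ hdkl)
  rw [h3, dirDeriv_const_mul hdiff,
    dirDeriv_add (hdk.inner ℝ hdl) (hd.inner ℝ hdkl), dirDeriv_inner hdk hdl,
    dirDeriv_inner hd hdkl, h1, dirDeriv_comm hU.1 (spaceDir l) (spaceDir k),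
    dirDeriv_comm (hU.dirDeriv (spaceDir l)).1 (spaceDir l) (spaceDir k),
    real_inner_comm (dirDeriv (spaceDir k) (dirDeriv (spaceDir l) U) p)
      (dirDeriv (spaceDir l) U p),
    real_inner_comm (dirDeriv (spaceDir k) U p)
      (dirDeriv (spaceDir l) (dirDeriv (spaceDir l) U) p)]
  ring

/-- Local conservation of momentum. -/
lemma dirDeriv_time_massCurrent (hU : UniformSchwartz U) {p₁ p₂ lam₁ lam₂ : ℝ} (hp₁ : 1 ≤ p₁)
    (hp₂ : 1 ≤ p₂) (h : SolvesNLS p₁ p₂ lam₁ lam₂ U) (k : Fin n) (p : ℝ × Ed n) :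
    dirDeriv timeDir (massCurrent U k) p =
      ∑ l, ((-1) * dirDeriv (spaceDir l) (stress U k l) p + 1 / 4 *
        dirDeriv (spaceDir l) (dirDeriv (spaceDir k) (dirDeriv (spaceDir l) (massDensity U))) p) +
      (-1) * pressureGrad p₁ p₂ lam₁ lam₂ U k p := by
  have hd := hU.differentiable
  have hdl2 : ∀ l, Differentiable ℝ (dirDeriv (spaceDir l) (dirDeriv (spaceDir l) U)) := fun l =>
    ((hU.dirDeriv (spaceDir l)).dirDeriv (spaceDir l)).differentiable
  have hdt := (hU.dirDeriv timeDir).differentiable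
  have hsum : Differentiable ℝ fun q =>
      ∑ l, dirDeriv (spaceDir l) (dirDeriv (spaceDir l) U) q := by
    fun_prop
  let L : ℝ × Ed n → ℂ := fun q => ∑ l, dirDeriv (spaceDir l) (dirDeriv (spaceDir l) U) q
  let r : ℝ × Ed n → ℝ := fun q =>
    lam₁ * massDensity U q ^ ((p₁ - 1) / 2) + lam₂ * massDensity U q ^ ((p₂ - 1) / 2)
  let G : ℝ × Ed n → ℂ := fun q => I * dirDeriv timeDir U q + 1 / 2 * L q
  have hG : ∀ q, G q = (r q : ℂ) * U q := by
    intro q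
    simp only [G, L, r, h q]
    ring
  have hGd : Differentiable ℝ G := (hdt.const_mul I).add (hsum.const_mul (1 / 2))
  have hUG : (fun q => inner ℝ (U q) (G q)) = fun q =>
      lam₁ * massDensity U q ^ ((p₁ + 1) / 2) + lam₂ * massDensity U q ^ ((p₂ + 1) / 2) := by
    funext q
    have hpow : ∀ {s : ℝ}, 1 ≤ s → massDensity U q ^ ((s + 1) / 2) =
        massDensity U q ^ ((s - 1) / 2) * massDensity U q := by
      intro s hs
      rw [← Real.rpow_add_one' (massDensity_nonneg U q) (by linarith)]
      congr 1
      ring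
    rw [hG, hpow hp₁, hpow hp₂, ← Complex.real_smul, real_inner_smul_right]
    simp only [r, massDensity]
    ring
  have hdUG : dirDeriv (spaceDir k) (fun q => inner ℝ (U q) (G q)) p =
      lam₁ * ((p₁ + 1) / 2) *
        (massDensity U p ^ ((p₁ - 1) / 2) * dirDeriv (spaceDir k) (massDensity U) p) +
      lam₂ * ((p₂ + 1) / 2) *
        (massDensity U p ^ ((p₂ - 1) / 2) * dirDeriv (spaceDir k) (massDensity U) p) := by
    have hf := (((hasFDerivAt_massDensity_rpow hU hp₁ p).const_mul lam₁).add
      ((hasFDerivAt_massDensity_rpow hU hp₂ p).const_mul lam₂)).fderiv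
    rw [hUG, dirDeriv]
    refine (DFunLike.congr_fun hf (spaceDir k)).trans ?_
    simp only [add_apply, smul_apply, smul_eq_mul, dirDeriv]
    ring
  rw [dirDeriv_inner hd hGd, hG p, ← Complex.real_smul, real_inner_smul_right,
    real_inner_comm] at hdUG
  have hDG : dirDeriv (spaceDir k) G p = I * dirDeriv (spaceDir k) (dirDeriv timeDir U) p +
      1 / 2 * ∑ l, dirDeriv (spaceDir k) (dirDeriv (spaceDir l) (dirDeriv (spaceDir l) U)) p := by
    rw [dirDeriv_add (hdt.const_mul I) (hsum.const_mul (1 / 2)), dirDeriv_const_mul hdt,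
      dirDeriv_const_mul hsum, dirDeriv_sum _ hdl2]
  have hj : dirDeriv timeDir (massCurrent U k) p =
      inner ℝ (I * dirDeriv timeDir U p) (dirDeriv (spaceDir k) U p) -
        inner ℝ (U p) (I * dirDeriv (spaceDir k) (dirDeriv timeDir U) p) := by
    refine (dirDeriv_inner (hd.const_mul I) (hU.dirDeriv (spaceDir k)).differentiable
      timeDir p).trans ?_
    rw [dirDeriv_const_mul hd, dirDeriv_comm hU.1 timeDir (spaceDir k), sub_eq_add_neg]
    congr 1
    simp [Complex.inner]
    ring
  have e1 : I * dirDeriv timeDir U p = r p • U p + (-(1 / 2) : ℝ) • L p := by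
    rw [Complex.real_smul, Complex.real_smul, ← hG p]
    simp only [G]
    push_cast
    ring
  have e2 : I * dirDeriv (spaceDir k) (dirDeriv timeDir U) p = dirDeriv (spaceDir k) G p +
      (-(1 / 2) : ℝ) •
        ∑ l, dirDeriv (spaceDir k) (dirDeriv (spaceDir l) (dirDeriv (spaceDir l) U)) p := by
    rw [hDG, Complex.real_smul]
    push_cast
    ring
  simp only [dirDeriv_stress_sub hU]
  rw [hj, e1, e2, inner_add_left, inner_add_right, real_inner_smul_left, real_inner_smul_left,
    real_inner_smul_right, Finset.sum_sub_distrib, ← Finset.mul_sum, ← Finset.mul_sum,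
    ← inner_sum, ← sum_inner]
  have hρ := dirDeriv_massDensity hU (spaceDir k) p
  simp only [pressureGrad]
  simp only [r, L] at hdUG ⊢
  linear_combination -hdUG - (lam₁ * massDensity U p ^ ((p₁ - 1) / 2) +
    lam₂ * massDensity U p ^ ((p₂ - 1) / 2)) * hρ

end ConservationLaws

/-! ### The Morawetz functional -/

section Morawetz

variable {n : ℕ} {ε : ℝ} {U : ℝ × Ed n → ℂ}

lemma pairing_regGrad_dirDeriv_right (hε : 0 < ε) (k l : Fin n) {f g : ℝ × Ed n → ℝ}
    (hf : UniformDecay f) (hg : UniformSchwartz g) (t : ℝ) :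
    pairing (regGrad ε k) f (dirDeriv (spaceDir l) g) t = -pairing (regHess ε k l) f g t :=
  (boundedKernel_regGrad hε k).pairing_deriv_right (boundedKernel_regHess hε k l) hf
    hg.uniformDecay (hg.dirDeriv _).uniformDecay (hasLineDerivAt_regGrad hε k l) t
    (hasLineDerivAt_space hg.differentiable l t)

lemma pairing_regHess_eq (hε : 0 < ε) (k l : Fin n) {f g : ℝ × Ed n → ℝ}
    (hf : UniformSchwartz f) (hg : UniformDecay g) (t : ℝ) :
    pairing (regHess ε k l) f g t = pairing (regGrad ε k) (dirDeriv (spaceDir l) f) g t :=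
  (boundedKernel_regGrad hε k).pairing_deriv_left (boundedKernel_regHess hε k l)
    hf.uniformDecay (hf.dirDeriv _).uniformDecay hg (hasLineDerivAt_regGrad hε k l) t
    (hasLineDerivAt_space hf.differentiable l t)

lemma pairing_regHess_grad_grad (hε : 0 < ε) (k l : Fin n) {f : ℝ × Ed n → ℝ}
    (hf : UniformSchwartz f) (t : ℝ) :
    pairing (regHess ε k l) (dirDeriv (spaceDir k) f) (dirDeriv (spaceDir l) f) t =
      pairing (regHess ε k k) (dirDeriv (spaceDir l) f) (dirDeriv (spaceDir l) f) t := by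
  rw [pairing_regHess_eq hε k l (hf.dirDeriv _) (hf.dirDeriv _).uniformDecay,
    pairing_regHess_eq hε k k (hf.dirDeriv _) (hf.dirDeriv _).uniformDecay,
    funext (dirDeriv_comm hf.1 (spaceDir l) (spaceDir k))]

/-- The regularised Morawetz functional `∫∫ ∇h(y - x) · ρ(t,x) j(t,y) dx dy`. -/
def morawetz (ε : ℝ) (U : ℝ × Ed n → ℂ) (t : ℝ) : ℝ :=
  ∑ k, pairing (regGrad ε k) (massDensity U) (massCurrent U k) t

/-- The space integrals in the Morawetz estimate, for a kernel `K` replacing `(n - 1) |x - y|⁻¹`. -/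
def morawetzDensity (p₁ p₂ lam₁ lam₂ : ℝ) (K : Ed n → ℝ) (U : ℝ × Ed n → ℂ) (t : ℝ) : ℝ :=
  1 / 2 * ∑ l, pairing K (dirDeriv (spaceDir l) (massDensity U))
      (dirDeriv (spaceDir l) (massDensity U)) t +
    pairing K (massDensity U) (pressure p₁ p₂ lam₁ lam₂ U) t

lemma regHess_form_nonneg (hε : 0 < ε) (z : Ed n) (a b : ℂ) (A B : Fin n → ℂ) :
    0 ≤ ∑ k, ∑ l, regHess ε k l z *
      (1 / 2 * (inner ℝ a a * inner ℝ (B k) (B l)) + 1 / 2 * (inner ℝ (A k) (A l) * inner ℝ b b) -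
        inner ℝ (I * a) (A l) * inner ℝ (I * b) (B k) -
        inner ℝ a (A k) * inner ℝ b (B l)) := by
  set X : Fin n → Fin n → ℝ := fun k l =>
    1 / 2 * (inner ℝ a a * inner ℝ (B k) (B l)) + 1 / 2 * (inner ℝ (A k) (A l) * inner ℝ b b) -
      inner ℝ (I * a) (A l) * inner ℝ (I * b) (B k) - inner ℝ a (A k) * inner ℝ b (B l) with hX
  have hswap : ∑ k, ∑ l, regHess ε k l z * X k l = ∑ k, ∑ l, regHess ε k l z * X l k := by
    rw [Finset.sum_comm]
    simp only [regHess_comm ε _ _ z]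
  have hsym : ∀ k l, X k l + X l k =
      (b * A k - a * B k).re * (b * A l - a * B l).re +
        (b * A k - a * B k).im * (b * A l - a * B l).im := by
    intro k l
    simp only [hX, Complex.inner, sub_re, sub_im, mul_re, mul_im, conj_re, conj_im, I_re, I_im]
    ring
  have h : 2 * ∑ k, ∑ l, regHess ε k l z * X k l =
      (∑ k, ∑ l, regHess ε k l z * ((b * A k - a * B k).re * (b * A l - a * B l).re)) +
      ∑ k, ∑ l, regHess ε k l z * ((b * A k - a * B k).im * (b * A l - a * B l).im) := by
    rw [two_mul]
    nth_rewrite 2 [hswap]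
    simp only [← Finset.sum_add_distrib, ← mul_add, hsym]
  linarith [regHess_nonneg hε z fun k => (b * A k - a * B k).re,
    regHess_nonneg hε z fun k => (b * A k - a * B k).im]

lemma pairing_regHess_form_nonneg (hε : 0 < ε) (hU : UniformSchwartz U) (t : ℝ) :
    0 ≤ ∑ k, ∑ l, (pairing (regHess ε k l) (massDensity U) (stress U k l) t -
      pairing (regHess ε k l) (massCurrent U l) (massCurrent U k) t -
      1 / 4 * pairing (regHess ε k l) (dirDeriv (spaceDir k) (massDensity U))
        (dirDeriv (spaceDir l) (massDensity U)) t) := by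
  have hK := fun k l : Fin n => boundedKernel_regHess hε k l
  have hρ := hU.massDensity.uniformDecay
  have hS := fun k l => (hU.stress k l).uniformDecay
  have hj := fun k => (hU.massCurrent k).uniformDecay
  have hD := fun k => (hU.massDensity.dirDeriv (spaceDir k)).uniformDecay
  have i1 := fun k l => ((hK k l).integrable_pairing hρ (hS k l) t).const_mul (1 / 2)
  have i2 := fun k l => ((hK k l).integrable_pairing (hS k l) hρ t).const_mul (1 / 2)
  have i3 := fun k l => (hK k l).integrable_pairing (hj l) (hj k) t
  have i4 := fun k l => ((hK k l).integrable_pairing (hD k) (hD l) t).const_mul (1 / 4)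
  let F : Fin n → Fin n → Ed n × Ed n → ℝ := fun k l p =>
    1 / 2 * (regHess ε k l (p.2 - p.1) * (massDensity U (t, p.1) * stress U k l (t, p.2))) +
      1 / 2 * (regHess ε k l (p.2 - p.1) * (stress U k l (t, p.1) * massDensity U (t, p.2))) -
      regHess ε k l (p.2 - p.1) * (massCurrent U l (t, p.1) * massCurrent U k (t, p.2)) -
      1 / 4 * (regHess ε k l (p.2 - p.1) * (dirDeriv (spaceDir k) (massDensity U) (t, p.1) *
        dirDeriv (spaceDir l) (massDensity U) (t, p.2)))
  have hterm : ∀ k l, pairing (regHess ε k l) (massDensity U) (stress U k l) t -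
      pairing (regHess ε k l) (massCurrent U l) (massCurrent U k) t -
      1 / 4 * pairing (regHess ε k l) (dirDeriv (spaceDir k) (massDensity U))
        (dirDeriv (spaceDir l) (massDensity U)) t =
      ∫ p, F k l p := by
    intro k l
    have hs := pairing_swap (f := massDensity U) (g := stress U k l) (regHess_neg ε k l) t
    have hhalf : pairing (regHess ε k l) (massDensity U) (stress U k l) t =
        1 / 2 * pairing (regHess ε k l) (massDensity U) (stress U k l) t +
        1 / 2 * pairing (regHess ε k l) (stress U k l) (massDensity U) t := by
      rw [← hs]; ring
    rw [hhalf]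
    simp only [pairing, ← integral_const_mul]
    rw [← integral_add (i1 k l) (i2 k l)]
    exact ((integral_sub (((i1 k l).add (i2 k l)).sub (i3 k l)) (i4 k l)).trans
      (congrArg (· - _) (integral_sub ((i1 k l).add (i2 k l)) (i3 k l)))).symm
  have hint : ∀ k l, Integrable (F k l) := fun k l =>
    (((i1 k l).add (i2 k l)).sub (i3 k l)).sub (i4 k l)
  simp only [hterm, ← integral_finsetSum Finset.univ fun l _ => hint _ l]
  rw [← integral_finsetSum _ fun k _ => integrable_finsetSum _ fun l _ => hint k l]
  refine integral_nonneg fun p => ?_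
  refine (regHess_form_nonneg hε (p.2 - p.1) (U (t, p.1)) (U (t, p.2))
    (fun k => dirDeriv (spaceDir k) U (t, p.1))
    fun k => dirDeriv (spaceDir k) U (t, p.2)).trans_eq ?_
  refine Finset.sum_congr rfl fun k _ => Finset.sum_congr rfl fun l _ => ?_
  simp only [F, dirDeriv_massDensity hU, massDensity, stress, massCurrent]
  ring

lemma pairing_time_massDensity (hε : 0 < ε) (hU : UniformSchwartz U) {p₁ p₂ lam₁ lam₂ : ℝ}
    (h : SolvesNLS p₁ p₂ lam₁ lam₂ U) (k : Fin n) (t : ℝ) :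
    pairing (regGrad ε k) (dirDeriv timeDir (massDensity U)) (massCurrent U k) t =
      -∑ l, pairing (regHess ε k l) (massCurrent U l) (massCurrent U k) t := by
  have hd := fun l => ((hU.massCurrent l).dirDeriv (spaceDir l)).uniformDecay
  rw [funext (dirDeriv_time_massDensity hU h),
    (boundedKernel_regGrad hε k).pairing_sum_left _ (fun l _ => (hd l).const_mul _)
      (hU.massCurrent k).uniformDecay, ← Finset.sum_neg_distrib]
  refine Finset.sum_congr rfl fun l _ => ?_
  rw [pairing_const_mul_left, pairing_regHess_eq hε k l (hU.massCurrent l)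
    (hU.massCurrent k).uniformDecay, neg_one_mul]

lemma pairing_time_massCurrent (hε : 0 < ε) (hU : UniformSchwartz U) {p₁ p₂ lam₁ lam₂ : ℝ}
    (hp₁ : 1 ≤ p₁) (hp₂ : 1 ≤ p₂) (h : SolvesNLS p₁ p₂ lam₁ lam₂ U) (k : Fin n) (t : ℝ) :
    pairing (regGrad ε k) (massDensity U) (dirDeriv timeDir (massCurrent U k)) t =
      ∑ l, (pairing (regHess ε k l) (massDensity U) (stress U k l) t +
        1 / 4 * pairing (regHess ε k k) (dirDeriv (spaceDir l) (massDensity U))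
          (dirDeriv (spaceDir l) (massDensity U)) t) +
      pairing (regHess ε k k) (massDensity U) (pressure p₁ p₂ lam₁ lam₂ U) t := by
  have hK := boundedKernel_regGrad hε k
  have hρ := hU.massDensity.uniformDecay
  have hS := fun l => ((hU.stress k l).dirDeriv (spaceDir l)).uniformDecay
  have hD := fun l => hU.massDensity.dirDeriv (spaceDir l)
  have hDD := fun l => (hD l).dirDeriv (spaceDir k)
  have hD3 := fun l => ((hDD l).dirDeriv (spaceDir l)).uniformDecay
  have hterm := fun l => ((hS l).const_mul (-1)).add ((hD3 l).const_mul (1 / 4))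
  have hP := hU.pressureGrad hp₁ hp₂ lam₁ lam₂ k
  have hpress : pairing (regGrad ε k) (massDensity U) (pressureGrad p₁ p₂ lam₁ lam₂ U k) t =
      -pairing (regHess ε k k) (massDensity U) (pressure p₁ p₂ lam₁ lam₂ U) t := by
    refine hK.pairing_deriv_right (boundedKernel_regHess hε k k) hρ
      (hU.pressure hp₁ hp₂ lam₁ lam₂) hP (hasLineDerivAt_regGrad hε k k) t fun x => ?_
    rw [← dirDeriv_pressure hU hp₁ hp₂]
    exact hasLineDerivAt_space (differentiable_pressure hU hp₁ hp₂ lam₁ lam₂) k t x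
  rw [funext (dirDeriv_time_massCurrent hU hp₁ hp₂ h k),
    hK.pairing_add_right hρ (UniformDecay.sum _ fun l _ => hterm l) (hP.const_mul _),
    hK.pairing_sum_right _ hρ fun l _ => hterm l, pairing_const_mul_right, hpress]
  congr 1
  · refine Finset.sum_congr rfl fun l _ => ?_
    rw [hK.pairing_add_right hρ ((hS l).const_mul _) ((hD3 l).const_mul _),
      pairing_const_mul_right, pairing_const_mul_right,
      pairing_regGrad_dirDeriv_right hε k l hρ (hU.stress k l),
      pairing_regGrad_dirDeriv_right hε k l hρ (hDD l),
      pairing_regHess_eq hε k l hU.massDensity (hDD l).uniformDecay,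
      pairing_regGrad_dirDeriv_right hε k k (hD l).uniformDecay (hD l)]
    ring
  · ring

lemma exists_deriv_morawetz_ge (hε : 0 < ε) (hU : UniformSchwartz U) {p₁ p₂ lam₁ lam₂ : ℝ}
    (hp₁ : 1 ≤ p₁) (hp₂ : 1 ≤ p₂) (h : SolvesNLS p₁ p₂ lam₁ lam₂ U) (t : ℝ) :
    ∃ m, HasDerivAt (morawetz ε U) m t ∧
      morawetzDensity p₁ p₂ lam₁ lam₂ (regLap ε) U t ≤ m := by
  have hρ := hU.massDensity
  refine ⟨_, HasDerivAt.fun_sum fun k _ => (boundedKernel_regGrad hε k).hasDerivAt_pairing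
    hρ.uniformDecay (hρ.dirDeriv timeDir).uniformDecay (hU.massCurrent k).uniformDecay
    ((hU.massCurrent k).dirDeriv timeDir).uniformDecay (hasDerivAt_time hρ.differentiable)
    (hasDerivAt_time (hU.massCurrent k).differentiable) t, ?_⟩
  have hlap : ∀ {f g : ℝ × Ed n → ℝ}, UniformDecay f → UniformDecay g →
      pairing (regLap ε) f g t = ∑ k, pairing (regHess ε k k) f g t := fun hf hg =>
    pairing_sum_kernel Finset.univ (fun k _ => boundedKernel_regHess hε k k) hf hg t
  have hD := fun l => (hρ.dirDeriv (spaceDir l)).uniformDecay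
  have hpos := pairing_regHess_form_nonneg hε hU t
  simp only [pairing_regHess_grad_grad hε _ _ hρ, Finset.sum_sub_distrib,
    ← Finset.mul_sum] at hpos
  simp only [pairing_time_massDensity hε hU h, pairing_time_massCurrent hε hU hp₁ hp₂ h,
    Finset.sum_add_distrib, Finset.sum_neg_distrib, ← Finset.mul_sum, morawetzDensity,
    hlap (hD _) (hD _), hlap hρ.uniformDecay (hU.pressure hp₁ hp₂ lam₁ lam₂)]
  rw [Finset.sum_comm (f := fun l k => pairing (regHess ε k k)
    (dirDeriv (spaceDir l) (massDensity U)) (dirDeriv (spaceDir l) (massDensity U)) t)]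
  linarith

end Morawetz

section Bound

variable {n : ℕ} {ε : ℝ} {U : ℝ × Ed n → ℂ}

/-- The norm of the space gradient. -/
def gradNorm (U : ℝ × Ed n → ℂ) (p : ℝ × Ed n) : ℝ := √(∑ k, ‖dirDeriv (spaceDir k) U p‖ ^ 2)

lemma gradNorm_sq (U : ℝ × Ed n → ℂ) (p : ℝ × Ed n) :
    gradNorm U p ^ 2 = ∑ k, ‖dirDeriv (spaceDir k) U p‖ ^ 2 :=
  Real.sq_sqrt (Finset.sum_nonneg fun _ _ => sq_nonneg _)

lemma sqrt_sum_massCurrent_sq_le (U : ℝ × Ed n → ℂ) (p : ℝ × Ed n) :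
    √(∑ k, massCurrent U k p ^ 2) ≤ ‖U p‖ * gradNorm U p := by
  refine Real.sqrt_le_iff.2 ⟨mul_nonneg (norm_nonneg _) (Real.sqrt_nonneg _), ?_⟩
  rw [mul_pow, gradNorm_sq, Finset.mul_sum]
  refine Finset.sum_le_sum fun k _ => ?_
  rw [← mul_pow, sq_le_sq, abs_of_nonneg (a := ‖U p‖ * _) (by positivity)]
  exact (abs_real_inner_le_norm _ _).trans_eq (by simp)

lemma memLp_norm_slice (hU : UniformSchwartz U) (t : ℝ) :
    MemLp (fun x => ‖U (t, x)‖) 2 := by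
  have hc : Continuous fun x => ‖U (t, x)‖ := (hU.1.continuous.comp (by fun_prop)).norm
  rw [memLp_two_iff_integrable_sq hc.aestronglyMeasurable]
  simpa only [massDensity_eq] using hU.massDensity.uniformDecay.integrable_slice t

lemma memLp_gradNorm_slice (hU : UniformSchwartz U) (t : ℝ) :
    MemLp (fun x => gradNorm U (t, x)) 2 := by
  have hk := fun k => (hU.dirDeriv (spaceDir k))
  have hc : Continuous fun x => gradNorm U (t, x) :=
    (continuous_finsetSum _ fun k _ => ((hk k).1.continuous.comp
      (by fun_prop : Continuous fun x => (t, x))).norm.pow 2).sqrt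
  rw [memLp_two_iff_integrable_sq hc.aestronglyMeasurable]
  simp only [gradNorm_sq, ← massDensity_eq]
  exact integrable_finsetSum _ fun k _ => (hk k).massDensity.uniformDecay.integrable_slice t

lemma abs_morawetz_le (hε : 0 < ε) (hU : UniformSchwartz U) (t : ℝ) :
    |morawetz ε U t| ≤ ((∫ x, ‖U (t, x)‖ ^ 2) ^ ((1 : ℝ) / 2)) ^ 3 *
      (∫ x, ∑ k, ‖dirDeriv (spaceDir k) U (t, x)‖ ^ 2) ^ ((1 : ℝ) / 2) := by
  have hN := memLp_norm_slice hU t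
  have hG := memLp_gradNorm_slice hU t
  have hρ := hU.massDensity.uniformDecay
  have hcs : ∫ x, ‖U (t, x)‖ * gradNorm U (t, x) ≤ (∫ x, ‖U (t, x)‖ ^ 2) ^ ((1 : ℝ) / 2) *
      (∫ x, ∑ k, ‖dirDeriv (spaceDir k) U (t, x)‖ ^ 2) ^ ((1 : ℝ) / 2) := by
    have h := integral_mul_le_Lp_mul_Lq_of_nonneg Real.HolderConjugate.two_two
      (μ := volume) (f := fun x => ‖U (t, x)‖) (g := fun x => gradNorm U (t, x))
      (Eventually.of_forall fun x => norm_nonneg _)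
      (Eventually.of_forall fun x => Real.sqrt_nonneg _) (by simpa using hN) (by simpa using hG)
    simpa only [Real.rpow_two, gradNorm_sq] using h
  have hA : ((∫ x, ‖U (t, x)‖ ^ 2) ^ ((1 : ℝ) / 2)) ^ 2 = ∫ x, ‖U (t, x)‖ ^ 2 := by
    rw [← Real.sqrt_eq_rpow, Real.sq_sqrt (integral_nonneg fun x => sq_nonneg _)]
  have hM : morawetz ε U t = ∫ p : Ed n × Ed n, massDensity U (t, p.1) *
      ∑ k, regGrad ε k (p.2 - p.1) * massCurrent U k (t, p.2) := by
    simp only [morawetz, pairing]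
    rw [← integral_finsetSum _ fun k _ => (boundedKernel_regGrad hε k).integrable_pairing hρ
      (hU.massCurrent k).uniformDecay t]
    refine integral_congr_ae (Eventually.of_forall fun p => ?_)
    simp only [Finset.mul_sum]
    exact Finset.sum_congr rfl fun k _ => by ring
  calc |morawetz ε U t|
      ≤ ∫ p : Ed n × Ed n, ‖U (t, p.1)‖ ^ 2 * (‖U (t, p.2)‖ * gradNorm U (t, p.2)) := by
        rw [hM, ← Real.norm_eq_abs]
        refine norm_integral_le_of_norm_le ?_ (Eventually.of_forall fun p => ?_)
        · exact hN.integrable_sq.mul_prod (hN.integrable_mul hG)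
        · rw [norm_mul, Real.norm_of_nonneg (massDensity_nonneg _ _), massDensity_eq]
          exact mul_le_mul_of_nonneg_left ((abs_sum_regGrad_mul_le hε _ _).trans
            (sqrt_sum_massCurrent_sq_le U _)) (sq_nonneg _)
    _ = (∫ x, ‖U (t, x)‖ ^ 2) * ∫ x, ‖U (t, x)‖ * gradNorm U (t, x) :=
        integral_prod_mul (fun x => ‖U (t, x)‖ ^ 2) fun y => ‖U (t, y)‖ * gradNorm U (t, y)
    _ ≤ _ := by
        rw [pow_succ, hA, mul_assoc]
        exact mul_le_mul_of_nonneg_left hcs (integral_nonneg fun x => sq_nonneg _)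

end Bound

section Limit

variable {n : ℕ} {U : ℝ × Ed n → ℂ} {p₁ p₂ lam₁ lam₂ : ℝ}

lemma continuous_morawetzDensity {K : Ed n → ℝ} (hK : BoundedKernel K) (hU : UniformSchwartz U)
    (hp₁ : 1 ≤ p₁) (hp₂ : 1 ≤ p₂) : Continuous (morawetzDensity p₁ p₂ lam₁ lam₂ K U) := by
  have hD := fun l => (hU.massDensity.dirDeriv (spaceDir l)).uniformDecay
  exact ((continuous_finsetSum _ fun l _ => hK.continuous_pairing (hD l) (hD l)).const_mul _).add
    (hK.continuous_pairing hU.massDensity.uniformDecay (hU.pressure hp₁ hp₂ lam₁ lam₂))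

lemma integral_morawetzDensity_regLap_le {ε : ℝ} (hε : 0 < ε) (hU : UniformSchwartz U)
    (hp₁ : 1 ≤ p₁) (hp₂ : 1 ≤ p₂) (h : SolvesNLS p₁ p₂ lam₁ lam₂ U) {C : ℝ}
    (hC : ∀ t, |morawetz ε U t| ≤ C) {T : ℝ} (hT : 0 ≤ T) :
    ∫ t in -T..T, morawetzDensity p₁ p₂ lam₁ lam₂ (regLap ε) U t ≤ 2 * C := by
  choose m hm hle using exists_deriv_morawetz_ge hε hU hp₁ hp₂ h
  have hI := intervalIntegral.integral_le_sub_of_hasDeriv_right_of_le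
    (by linarith : -T ≤ T) (fun t _ => (hm t).continuousAt.continuousWithinAt)
    (fun t _ => (hm t).hasDerivWithinAt)
    ((continuous_morawetzDensity (boundedKernel_regLap hε) hU hp₁ hp₂).integrableOn_Icc)
    (fun t _ => hle t)
  linarith [abs_le.1 (hC T), abs_le.1 (hC (-T))]

lemma tendsto_integral_morawetzDensity (hn : 2 ≤ n) (hU : UniformSchwartz U) (hp₁ : 1 ≤ p₁)
    (hp₂ : 1 ≤ p₂) (a b : ℝ) :
    Tendsto (fun ε => ∫ t in a..b, morawetzDensity p₁ p₂ lam₁ lam₂ (regLap ε) U t)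
      (nhdsWithin 0 (Set.Ioi 0))
      (nhds (∫ t in a..b,
        morawetzDensity p₁ p₂ lam₁ lam₂ (fun z => (n - 1) * ‖z‖⁻¹) U t)) := by
  have hD := fun l => (hU.massDensity.dirDeriv (spaceDir l)).uniformDecay
  have hρ := hU.massDensity.uniformDecay
  have hP := hU.pressure hp₁ hp₂ lam₁ lam₂
  choose C hC using fun l => exists_pairing_regLap_bound hn (hD l) (hD l) (min a b) (max a b)
  obtain ⟨D, hD'⟩ := exists_pairing_regLap_bound hn hρ hP (min a b) (max a b)
  refine intervalIntegral.tendsto_integral_filter_of_dominated_convergence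
    (fun _ => 1 / 2 * ∑ l, C l + D) ?_ ?_ intervalIntegrable_const ?_
  · filter_upwards [self_mem_nhdsWithin] with ε hε
    exact (continuous_morawetzDensity (boundedKernel_regLap hε) hU hp₁ hp₂).aestronglyMeasurable
  · refine Eventually.of_forall fun ε => Eventually.of_forall fun t ht => ?_
    have ht' : t ∈ Set.Icc (min a b) (max a b) := Set.Ioc_subset_Icc_self ht
    refine (norm_add_le _ _).trans (add_le_add ?_ (hD' ε t ht'))
    rw [norm_mul, Real.norm_of_nonneg (by norm_num : (0 : ℝ) ≤ 1 / 2)]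
    exact mul_le_mul_of_nonneg_left (norm_sum_le_of_le _ fun l _ => hC l ε t ht') (by norm_num)
  · refine Eventually.of_forall fun t _ => ?_
    exact ((tendsto_finsetSum _ fun l _ => tendsto_pairing_regLap hn (hD l) (hD l) t).const_mul
      _).add (tendsto_pairing_regLap hn hρ hP t)

lemma integral_morawetzDensity_le (hn : 2 ≤ n) (hU : UniformSchwartz U) (hp₁ : 1 ≤ p₁)
    (hp₂ : 1 ≤ p₂) (h : SolvesNLS p₁ p₂ lam₁ lam₂ U) {C : ℝ} (hC0 : 0 ≤ C)
    (hC : ∀ ε t, 0 < ε → |morawetz ε U t| ≤ C) :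
    ∫ t, morawetzDensity p₁ p₂ lam₁ lam₂ (fun z => (n - 1) * ‖z‖⁻¹) U t ≤ 2 * C := by
  by_cases hi : Integrable (morawetzDensity p₁ p₂ lam₁ lam₂ (fun z => (n - 1) * ‖z‖⁻¹) U)
  · refine le_of_tendsto
      (intervalIntegral_tendsto_integral hi tendsto_neg_atTop_atBot tendsto_id) ?_
    filter_upwards [eventually_ge_atTop 0] with T hT
    refine le_of_tendsto (tendsto_integral_morawetzDensity hn hU hp₁ hp₂ (-T) T) ?_
    filter_upwards [self_mem_nhdsWithin] with ε hε
    exact integral_morawetzDensity_regLap_le hε hU hp₁ hp₂ h (fun t => hC ε t hε) hT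
  · rw [integral_undef hi]
    positivity

lemma sum_pairing_inv_norm {ι : Type*} [Fintype ι] (hn : 2 ≤ n) {f g : ι → ℝ × Ed n → ℝ}
    (hf : ∀ i, UniformDecay (f i)) (hg : ∀ i, UniformDecay (g i)) (c t : ℝ) :
    ∑ i, pairing (fun z => c * ‖z‖⁻¹) (f i) (g i) t =
      c * ∫ x, ∫ y, ‖x - y‖⁻¹ * ∑ i, f i (t, x) * g i (t, y) := by
  have hi := fun i => integrable_inv_norm_pairing hn (hf i) (hg i) c t
  simp only [pairing]
  rw [← integral_finsetSum _ fun i _ => hi i, Measure.volume_eq_prod,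
    integral_prod _ (integrable_finsetSum _ fun i _ => hi i)]
  simp only [← Finset.mul_sum, mul_assoc, integral_const_mul, norm_sub_rev]

end Limit

section Translation

variable {n : ℕ} {u : ℝ → Ed n → ℂ}

lemma IsNLSSolution.uniformSchwartz {g : ℝ → ℝ} (hu : IsNLSSolution g u) :
    UniformSchwartz fun p : ℝ × Ed n => u p.1 p.2 :=
  ⟨hu.1, fun N m a b => hu.2.1 N m a b⟩

lemma IsNLSSolution.solvesNLS {p₁ p₂ lam₁ lam₂ : ℝ}
    (hu : IsNLSSolution (fun r => lam₁ * r ^ ((p₁ - 1) / 2) + lam₂ * r ^ ((p₂ - 1) / 2)) u) :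
    SolvesNLS p₁ p₂ lam₁ lam₂ fun p : ℝ × Ed n => u p.1 p.2 := by
  rintro ⟨t, x⟩
  have hU := hu.uniformSchwartz
  have h := hu.2.2 t x
  have h1 : ∀ k y, pd k (u t) y = dirDeriv (spaceDir k) (fun p : ℝ × Ed n => u p.1 p.2) (t, y) :=
    fun k y => fderiv_slice hU.differentiable k t y
  have h2 : lapC (u t) x = ∑ k, dirDeriv (spaceDir k) (dirDeriv (spaceDir k)
      fun p : ℝ × Ed n => u p.1 p.2) (t, x) := by
    refine Finset.sum_congr rfl fun k _ => ?_
    rw [funext (h1 k)]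
    exact fderiv_slice (hU.dirDeriv _).differentiable k t x
  rw [(hasDerivAt_time hU.differentiable t x).deriv, h2] at h
  rw [h, massDensity_eq]

lemma integrand_eq_morawetzDensity (hn : 2 ≤ n)
    (hU : UniformSchwartz fun p : ℝ × Ed n => u p.1 p.2) {p₁ p₂ : ℝ} (hp₁ : 1 ≤ p₁)
    (hp₂ : 1 ≤ p₂) (lam₁ lam₂ t : ℝ) :
    (((n : ℝ) - 1)/2) * (∫ x, ∫ y, ‖x - y‖⁻¹ *
          ∑ k, pdR k (fun z => dens u t z) x * pdR k (fun z => dens u t z) y)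
      + (((n : ℝ) - 1) * ∫ x, ∫ y, dens u t x * ‖x - y‖⁻¹ *
          (lam₁ * ((p₁ - 1)/(p₁ + 1)) * dens u t y ^ ((p₁ + 1)/2)
            + lam₂ * ((p₂ - 1)/(p₂ + 1)) * dens u t y ^ ((p₂ + 1)/2))) =
    morawetzDensity p₁ p₂ lam₁ lam₂ (fun z => (n - 1) * ‖z‖⁻¹) (fun p => u p.1 p.2) t := by
  have hρ := hU.massDensity
  have hD := fun k => (hρ.dirDeriv (spaceDir k)).uniformDecay
  have hdens : ∀ x, dens u t x = massDensity (fun p : ℝ × Ed n => u p.1 p.2) (t, x) :=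
    fun x => (massDensity_eq (fun p : ℝ × Ed n => u p.1 p.2) (t, x)).symm
  have hpd : ∀ k x, pdR k (fun z => dens u t z) x =
      dirDeriv (spaceDir k) (massDensity fun p : ℝ × Ed n => u p.1 p.2) (t, x) := by
    intro k x
    rw [funext hdens]
    exact fderiv_slice hρ.differentiable k t x
  have hsingle := sum_pairing_inv_norm hn (ι := Unit) (fun _ => hρ.uniformDecay)
    (fun _ => hU.pressure hp₁ hp₂ lam₁ lam₂) (n - 1) t
  simp only [Finset.univ_unique, Finset.sum_singleton] at hsingle
  rw [morawetzDensity, sum_pairing_inv_norm hn hD hD, hsingle]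
  simp only [hpd]
  congr 1
  · ring
  · simp only [hdens, pressure, mul_left_comm, mul_assoc]

end Translation

/-- Quadratic Morawetz estimate for the defocusing NLS with
`g(ρ) = λ₁ρ^{(p₁-1)/2} + λ₂ρ^{(p₂-1)/2}`, `λ₁, λ₂ ≥ 0`, `1 ≤ p₁ < p₂`, in kernel form:
the space-time integral of
`((n-1)/2)∫∫ ∇ρ(x)·∇ρ(y)|x-y|⁻¹ + (n-1)∫∫ ρ(x)|x-y|⁻¹(ρg(ρ)-G(ρ))(y)` is bounded by
`2 (sup_t ‖u(t)‖₂)³ (sup_t ‖∇u(t)‖₂)`. -/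
theorem nls_quadratic_morawetz_estimate {n : ℕ} (hn : 2 ≤ n)
    (p₁ p₂ lam₁ lam₂ : ℝ) (hp₁ : 1 ≤ p₁) (hp : p₁ < p₂) (hl₁ : 0 ≤ lam₁) (hl₂ : 0 ≤ lam₂)
    (u : ℝ → Ed n → ℂ)
    (hu : IsNLSSolution (fun r => lam₁ * r ^ ((p₁ - 1)/2) + lam₂ * r ^ ((p₂ - 1)/2)) u)
    (hA : BddAbove (Set.range fun t => (∫ x, ‖u t x‖ ^ 2) ^ ((1:ℝ)/2)))
    (hB : BddAbove (Set.range fun t => (∫ x, ∑ k, ‖pd k (u t) x‖ ^ 2) ^ ((1:ℝ)/2))) :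
    (∫ t : ℝ,
      ((((n : ℝ) - 1)/2) * ∫ x, ∫ y, ‖x - y‖⁻¹ *
          ∑ k, pdR k (fun z => dens u t z) x * pdR k (fun z => dens u t z) y)
      + (((n : ℝ) - 1) * ∫ x, ∫ y, dens u t x * ‖x - y‖⁻¹ *
          (lam₁ * ((p₁ - 1)/(p₁ + 1)) * dens u t y ^ ((p₁ + 1)/2)
            + lam₂ * ((p₂ - 1)/(p₂ + 1)) * dens u t y ^ ((p₂ + 1)/2))))
    ≤ 2 * (⨆ t : ℝ, (∫ x, ‖u t x‖ ^ 2) ^ ((1:ℝ)/2)) ^ 3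
        * (⨆ t : ℝ, (∫ x, ∑ k, ‖pd k (u t) x‖ ^ 2) ^ ((1:ℝ)/2)) := by
  have hU := hu.uniformSchwartz
  have hp₂ : 1 ≤ p₂ := hp₁.trans hp.le
  have hpd : ∀ k t x, pd k (u t) x =
      dirDeriv (spaceDir k) (fun p : ℝ × Ed n => u p.1 p.2) (t, x) :=
    fun k t x => fderiv_slice hU.differentiable k t x
  simp only [integrand_eq_morawetzDensity hn hU hp₁ hp₂]
  rw [mul_assoc]
  have hA0 : 0 ≤ ⨆ t : ℝ, (∫ x, ‖u t x‖ ^ 2) ^ ((1:ℝ)/2) :=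
    Real.iSup_nonneg fun t => Real.rpow_nonneg (integral_nonneg fun x => by positivity) _
  have hB' : ∀ t, 0 ≤ (∫ x, ∑ k, ‖pd k (u t) x‖ ^ 2) ^ ((1:ℝ)/2) := fun t =>
    Real.rpow_nonneg (integral_nonneg fun x => by positivity) _
  have hB0 := Real.iSup_nonneg hB'
  refine integral_morawetzDensity_le hn hU hp₁ hp₂ hu.solvesNLS (by positivity) fun ε t hε => ?_
  refine (abs_morawetz_le hε hU t).trans ?_
  simp only [← hpd]
  exact mul_le_mul (pow_le_pow_left₀
    (Real.rpow_nonneg (integral_nonneg fun x => by positivity) _) (le_ciSup hA t) 3)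
    (le_ciSup hB t) (hB' t) (by positivity)
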